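/- Let L be a Lelek fan and Y a non-degenerate continuum. The following are equivalent: (1) there is an embedding e : Y → L admitting a monotone retraction from L onto e(Y); (2) there is a monotone surjection f : L → Y; (3) Y is a Lelek fan. -/

import Mathlib

open Set Topology Filter

section Defs
variable {X : Type*} [TopologicalSpace X]

def IsSubcontinuum (A : Set X) : Prop := IsCompact A ∧ IsConnected A

def IsArc (A : Set X) : Prop := Nonempty (A ≃ₜ (Set.Icc (0:ℝ) 1))

def IsEndpointOfArc (A : Set X) (x : X) : Prop :=
  ∃ φ : (Set.Icc (0:ℝ) 1) ≃ₜ A, ((φ ⟨0, by norm_num⟩ : A) : X) = x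

def IsArcFromTo (A : Set X) (x y : X) : Prop :=
  (x = y ∧ A = {x}) ∨ (x ≠ y ∧ IsArc A ∧ IsEndpointOfArc A x ∧ IsEndpointOfArc A y)

def IsArcwiseConnected (K : Set X) : Prop :=
  ∀ x ∈ K, ∀ y ∈ K, x ≠ y →
    ∃ A, A ⊆ K ∧ IsArc A ∧ IsEndpointOfArc A x ∧ IsEndpointOfArc A y

def IsUnicoherent (K : Set X) : Prop :=
  ∀ A B : Set X, IsSubcontinuum A → IsSubcontinuum B → A ∪ B = K → IsConnected (A ∩ B)

def IsDendroid (K : Set X) : Prop :=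
  IsSubcontinuum K ∧ IsArcwiseConnected K ∧
    ∀ A, A ⊆ K → IsSubcontinuum A → IsUnicoherent A

def triodModel : Set (ℝ × ℝ) := (Set.Icc (-1) 1 ×ˢ ({0} : Set ℝ)) ∪ (({0} : Set ℝ) ×ˢ Set.Icc 0 1)

lemma triod_top_mem : ((0, 0) : ℝ × ℝ) ∈ triodModel := by
  left; exact ⟨by norm_num, rfl⟩

def IsSimpleTriodWithTop (T : Set X) (x : X) : Prop :=
  ∃ φ : triodModel ≃ₜ T, ((φ ⟨(0, 0), triod_top_mem⟩ : T) : X) = x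

def IsRamificationPoint (K : Set X) (x : X) : Prop :=
  x ∈ K ∧ ∃ T, T ⊆ K ∧ IsSimpleTriodWithTop T x

def IsEndpoint (K : Set X) (x : X) : Prop :=
  x ∈ K ∧ ∀ A, A ⊆ K → IsArc A → x ∈ A → IsEndpointOfArc A x

def IsFan (K : Set X) : Prop :=
  IsDendroid K ∧ ∀ x y, IsRamificationPoint K x → IsRamificationPoint K y → x = y

def IsFanWithTop (K : Set X) (v : X) : Prop := IsFan K ∧ IsRamificationPoint K v

def Legs (K : Set X) (v : X) : Set (Set X) :=
  {A | ∃ e, IsEndpoint K e ∧ A ⊆ K ∧ IsArcFromTo A v e}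

def IsRetractOf (B A : Set X) : Prop :=
  ∃ r : X → X, ContinuousOn r A ∧ Set.MapsTo r A B ∧ Set.EqOn r id B

end Defs

section MetricDefs
variable {X : Type*} [MetricSpace X]

def IsSmoothFan (K : Set X) (v : X) : Prop :=
  IsFanWithTop K v ∧
  ∀ x ∈ K, ∀ xs : ℕ → X, (∀ n, xs n ∈ K) → Tendsto xs atTop (nhds x) →
    ∀ A : Set X, A ⊆ K → IsArcFromTo A v x →
    ∀ As : ℕ → Set X, (∀ n, As n ⊆ K ∧ IsArcFromTo (As n) v (xs n)) →
      Tendsto (fun n => Metric.hausdorffDist (As n) A) atTop (nhds 0)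

def IsLelekFan (K : Set X) (v : X) : Prop :=
  IsSmoothFan K v ∧ K ⊆ closure {x | IsEndpoint K x}

def IsWedge (L : Set X) (v : X) (W : Set X) : Prop :=
  W ⊆ L ∧ IsSubcontinuum W ∧ IsLelekFan W v ∧ IsLelekFan ((L \ W) ∪ {v}) v

end MetricDefs

def coneSetoid (Z : Type*) : Setoid (Z × Set.Icc (0:ℝ) 1) where
  r a b := a = b ∨ ((a.2 : ℝ) = 0 ∧ (b.2 : ℝ) = 0)
  iseqv := by
    refine ⟨fun a => Or.inl rfl, ?_, ?_⟩
    · rintro a b (rfl | h)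
      · exact Or.inl rfl
      · exact Or.inr ⟨h.2, h.1⟩
    · rintro a b c (rfl | h) (rfl | h')
      · exact Or.inl rfl
      · exact Or.inr h'
      · exact Or.inr h
      · exact Or.inr ⟨h.1, h'.2⟩

abbrev CantorFanSpace : Type := Quotient (coneSetoid (ℕ → Bool))

def IsCantorFan {X : Type*} [TopologicalSpace X] (K : Set X) (v : X) : Prop :=
  IsFanWithTop K v ∧ Nonempty (K ≃ₜ CantorFanSpace)

def IsConfluent {X Y : Type*} [TopologicalSpace X] [TopologicalSpace Y] (f : X → Y) : Prop :=
  ∀ Q : Set Y, Q ⊆ Set.range f → IsCompact Q → IsConnected Q →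
    ∀ x ∈ f ⁻¹' Q, f '' connectedComponentIn (f ⁻¹' Q) x = Q

section GeneralTopology

variable {X Y : Type*} [TopologicalSpace X] [TopologicalSpace Y]

lemma IsCompact.isPreconnected_of_image [T2Space Y] {A B : Set X} {σ : X → Y}
    (hA : IsCompact A) (hσ : ContinuousOn σ A) (hinj : InjOn σ A) (hBA : B ⊆ A)
    (hB : IsPreconnected (σ '' B)) : IsPreconnected B := by
  have : CompactSpace A := isCompact_iff_compactSpace.mp hA
  have hemb : IsClosedEmbedding (A.domRestrict σ) :=
    hσ.domRestrict.isClosedEmbedding hinj.injective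
  have himg : A.domRestrict σ '' (Subtype.val ⁻¹' B) = σ '' B := by
    ext y
    constructor
    · rintro ⟨⟨a, ha⟩, hb, rfl⟩
      exact ⟨a, hb, rfl⟩
    · rintro ⟨b, hb, rfl⟩
      exact ⟨⟨b, hBA hb⟩, hb, rfl⟩
  have h1 : IsPreconnected ((Subtype.val : A → X) ⁻¹' B) := by
    rw [← hemb.isInducing.isPreconnected_image, himg]
    exact hB
  have h2 := h1.image _ continuous_subtype_val.continuousOn
  rwa [Subtype.image_preimage_coe, inter_eq_self_of_subset_right hBA] at h2

lemma IsCompact.exists_isClosed_partition [T2Space X] {K A B : Set X} (hK : IsCompact K)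
    (hA : IsClosed A) (hB : IsClosed B) (hAK : A ⊆ K) (hBK : B ⊆ K)
    (hQ : ∀ Q, Q ⊆ K → IsClosed Q → IsPreconnected Q → ∀ a ∈ A, ∀ b ∈ B, a ∈ Q → b ∉ Q) :
    ∃ C D, IsClosed C ∧ IsClosed D ∧ C ∪ D = K ∧ Disjoint C D ∧ A ⊆ C ∧ B ⊆ D := by
  have : CompactSpace K := isCompact_iff_compactSpace.mp hK
  let π : K → ConnectedComponents K := ConnectedComponents.mk
  have hπ : Continuous π := ConnectedComponents.continuous_coe
  have hA' : IsClosed (π '' (Subtype.val ⁻¹' A)) :=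
    ((hA.preimage continuous_subtype_val).isCompact.image hπ).isClosed
  have hB' : IsClosed (π '' (Subtype.val ⁻¹' B)) :=
    ((hB.preimage continuous_subtype_val).isCompact.image hπ).isClosed
  have hsub : π '' (Subtype.val ⁻¹' A) ⊆ (π '' (Subtype.val ⁻¹' B))ᶜ := by
    rintro _ ⟨a, ha, rfl⟩ ⟨b, hb, hab⟩
    have hab' : connectedComponent b = connectedComponent a := ConnectedComponents.coe_eq_coe.mp hab
    refine hQ (Subtype.val '' connectedComponent a) ?_ ?_ ?_ a ha b hb
      ⟨a, mem_connectedComponent, rfl⟩ ⟨b, hab' ▸ mem_connectedComponent, rfl⟩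
    · rintro _ ⟨x, -, rfl⟩
      exact x.2
    · exact (isClosed_connectedComponent.isCompact.image continuous_subtype_val).isClosed
    · exact isPreconnected_connectedComponent.image _ continuous_subtype_val.continuousOn
  obtain ⟨W, hW, hAW, hWB⟩ := exists_clopen_of_closed_subset_open hA' hB'.isOpen_compl hsub
  have hWc : IsClopen (π ⁻¹' W) := hW.preimage hπ
  refine ⟨Subtype.val '' (π ⁻¹' W), Subtype.val '' (π ⁻¹' W)ᶜ,
    (hWc.isClosed.isCompact.image continuous_subtype_val).isClosed,
    (hWc.compl.isClosed.isCompact.image continuous_subtype_val).isClosed, ?_, ?_, ?_, ?_⟩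
  · rw [← image_union, union_compl_self, image_univ, Subtype.range_coe]
  · exact (disjoint_image_iff Subtype.val_injective).mpr disjoint_compl_right
  · intro a ha
    exact ⟨⟨a, hAK ha⟩, hAW ⟨⟨a, hAK ha⟩, ha, rfl⟩, rfl⟩
  · intro b hb
    exact ⟨⟨b, hBK hb⟩, fun h => hWB h ⟨⟨b, hBK hb⟩, hb, rfl⟩, rfl⟩

lemma IsPreconnected.preimage_of_preconnected_fibers {f : X → Y} (hf : Continuous f)
    (hcl : IsClosedMap f) (hfib : ∀ y, IsConnected (f ⁻¹' {y})) {Q : Set Y} (hQc : IsClosed Q)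
    (hQ : IsPreconnected Q) : IsPreconnected (f ⁻¹' Q) := by
  have hP : IsClosed (f ⁻¹' Q) := hQc.preimage hf
  rw [isPreconnected_iff_subset_of_fully_disjoint_closed hP]
  intro A B hA hB hAB hdisj
  have hfibre : ∀ y ∈ Q, f ⁻¹' {y} ⊆ A ∨ f ⁻¹' {y} ⊆ B := by
    intro y hy
    have hs : f ⁻¹' {y} ⊆ A ∪ B := fun x hx => hAB (by rw [mem_preimage, hx]; exact hy)
    refine isPreconnected_iff_subset_of_disjoint_closed.mp (hfib y).isPreconnected A B hA hB hs ?_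
    rw [hdisj.inter_eq, inter_empty]
  have hcov : Q ⊆ f '' (f ⁻¹' Q ∩ A) ∪ f '' (f ⁻¹' Q ∩ B) := by
    intro y hy
    obtain ⟨x, hx⟩ := (hfib y).nonempty
    have hxQ : x ∈ f ⁻¹' Q := by rw [mem_preimage, hx]; exact hy
    rcases hAB hxQ with h | h
    · exact Or.inl ⟨x, ⟨hxQ, h⟩, hx⟩
    · exact Or.inr ⟨x, ⟨hxQ, h⟩, hx⟩
  have hdis : Q ∩ (f '' (f ⁻¹' Q ∩ A) ∩ f '' (f ⁻¹' Q ∩ B)) = ∅ := by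
    rw [eq_empty_iff_forall_notMem]
    rintro y ⟨hy, ⟨x, ⟨-, hxA⟩, hx⟩, ⟨x', ⟨-, hxB⟩, hx'⟩⟩
    rcases hfibre y hy with h | h
    · exact disjoint_left.mp hdisj (h hx') hxB
    · exact disjoint_left.mp hdisj hxA (h hx)
  have key := isPreconnected_iff_subset_of_disjoint_closed.mp hQ _ _ (hcl _ (hP.inter hA))
    (hcl _ (hP.inter hB)) hcov hdis
  refine key.imp (fun h x hx => ?_) (fun h x hx => ?_)
  · obtain ⟨x', ⟨-, hx'A⟩, hxx'⟩ := h hx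
    rcases hfibre _ hx with h' | h'
    · exact h' rfl
    · exact absurd (h' hxx') (disjoint_left.mp hdisj hx'A)
  · obtain ⟨x', ⟨-, hx'B⟩, hxx'⟩ := h hx
    rcases hfibre _ hx with h' | h'
    · exact absurd hx'B (disjoint_left.mp hdisj (h' hxx'))
    · exact h' rfl

end GeneralTopology

/-- A closed partial order with least point `v` whose down-sets are connected chains and in which
every subcontinuum missing `v` is a chain. -/
structure FanOrder {Z : Type*} [TopologicalSpace Z] (v : Z) (R : Z → Z → Prop) : Prop where
  refl : ∀ a, R a a
  trans : ∀ {a b c}, R a b → R b c → R a c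
  antisymm : ∀ {a b}, R a b → R b a → a = b
  bot : ∀ a, R v a
  closed : IsClosed {p : Z × Z | R p.1 p.2}
  conn : ∀ a, IsPreconnected {x | R x a}
  chain : ∀ {a b c}, R a c → R b c → R a b ∨ R b a
  chain_of_isPreconnected : ∀ {Q : Set Z}, IsClosed Q → IsPreconnected Q → v ∉ Q →
    ∀ {a b}, a ∈ Q → b ∈ Q → R a b ∨ R b a

namespace FanOrder

section
variable {Z : Type*} [TopologicalSpace Z] {v : Z} {R : Z → Z → Prop} (h : FanOrder v R)
include h

lemma isClosed_lower (a : Z) : IsClosed {x | R x a} :=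
  h.closed.preimage (f := fun x => (x, a)) (by fun_prop)

lemma isClosed_upper (a : Z) : IsClosed {x | R a x} :=
  h.closed.preimage (f := fun x => (a, x)) (by fun_prop)

lemma eventually_lower_subset [CompactSpace Z] {O : Set Z} (hO : IsOpen O) {z : Z}
    (hz : {x | R x z} ⊆ O) : ∀ᶠ y in 𝓝 z, {x | R x y} ⊆ O := by
  have hF : IsClosed (Prod.snd '' ({p : Z × Z | R p.1 p.2} ∩ Prod.fst ⁻¹' Oᶜ)) :=
    isClosedMap_snd_of_compactSpace _
      (h.closed.inter (hO.isClosed_compl.preimage continuous_fst))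
  have hmem : z ∈ (Prod.snd '' ({p : Z × Z | R p.1 p.2} ∩ Prod.fst ⁻¹' Oᶜ))ᶜ := by
    rintro ⟨⟨a, b⟩, ⟨hab, ha⟩, rfl⟩
    exact ha (hz hab)
  filter_upwards [hF.isOpen_compl.mem_nhds hmem] with y hy x hx
  by_contra hxO
  exact hy ⟨(x, y), ⟨hx, hxO⟩, rfl⟩

lemma eventually_exists_lower_mem [CompactSpace Z] [T2Space Z] {O : Set Z} (hO : IsOpen O)
    {a z : Z} (haz : R a z) (ha : a ∈ O) : ∀ᶠ y in 𝓝 z, ∃ b ∈ O, R b y := by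
  by_cases hv : v ∈ O
  · exact Eventually.of_forall fun y => ⟨v, hv, h.bot y⟩
  by_cases hz : z ∈ O
  · filter_upwards [hO.mem_nhds hz] with y hy
    exact ⟨y, hy, h.refl y⟩
  have hP : IsClosed ({x | R x a} \ O) := (h.isClosed_lower a).sdiff hO
  have hQ : IsClosed (({x | R a x} ∩ {x | R x z}) \ O) :=
    ((h.isClosed_upper a).inter (h.isClosed_lower z)).sdiff hO
  have hdisj : Disjoint ({x | R x a} \ O) (({x | R a x} ∩ {x | R x z}) \ O) := by
    rw [disjoint_left]
    rintro x ⟨hx, hxO⟩ ⟨⟨hx', -⟩, -⟩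
    exact hxO (h.antisymm hx' hx ▸ ha)
  obtain ⟨O₁, O₂, hO₁, hO₂, hPO, hQO, hdis⟩ := normal_separation hP hQ hdisj
  have hsub : {x | R x z} ⊆ O₁ ∪ O₂ ∪ O := by
    intro x hx
    by_cases hxO : x ∈ O
    · exact Or.inr hxO
    rcases h.chain hx haz with h1 | h1
    · exact Or.inl (Or.inl (hPO ⟨h1, hxO⟩))
    · exact Or.inl (Or.inr (hQO ⟨⟨h1, hx⟩, hxO⟩))
  filter_upwards [h.eventually_lower_subset ((hO₁.union hO₂).union hO) hsub,
    hO₂.mem_nhds (hQO ⟨⟨haz, h.refl z⟩, hz⟩)] with y hy hyO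
  by_contra! hno
  have hsub' : {x | R x y} ⊆ O₁ ∪ O₂ := fun x hx =>
    (hy hx).resolve_right fun hxO => hno x hxO hx
  obtain ⟨x, -, hx₁, hx₂⟩ := h.conn y O₁ O₂ hO₁ hO₂ hsub'
    ⟨v, h.bot y, hPO ⟨h.bot a, hv⟩⟩ ⟨y, h.refl y, hyO⟩
  exact disjoint_left.mp hdis hx₁ hx₂

end

section
variable {Z : Type*} [MetricSpace Z] [CompactSpace Z] {v : Z} {R : Z → Z → Prop}
  (h : FanOrder v R)
include h

lemma continuous_infDist_lower (d : Z) : Continuous fun z => Metric.infDist d {x | R x z} := by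
  rw [continuous_iff_continuousAt]
  intro z
  rw [ContinuousAt, Metric.tendsto_nhds]
  intro ε hε
  obtain ⟨a, ha, hda⟩ := (h.isClosed_lower z).isCompact.exists_infDist_eq_dist
    ⟨z, h.refl z⟩ d
  have hO : IsOpen {x | Metric.infDist d {x | R x z} - ε < dist d x} :=
    isOpen_lt continuous_const (by fun_prop)
  have hsub : {x | R x z} ⊆ {x | Metric.infDist d {x | R x z} - ε < dist d x} := fun x hx => by
    have := Metric.infDist_le_dist_of_mem (x := d) (show x ∈ {x | R x z} from hx)
    simp only [mem_ofPred_eq]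
    linarith
  filter_upwards [h.eventually_exists_lower_mem (Metric.isOpen_ball (x := a) (ε := ε)) ha
    (Metric.mem_ball_self hε), h.eventually_lower_subset hO hsub] with y ⟨b, hb, hby⟩ hy
  obtain ⟨c, hc, hdc⟩ := (h.isClosed_lower y).isCompact.exists_infDist_eq_dist
    ⟨y, h.refl y⟩ d
  have h1 := Metric.infDist_le_dist_of_mem (x := d) (show b ∈ {x | R x y} from hby)
  have h2 := dist_triangle d a b
  have h3 : dist b a < ε := hb
  rw [dist_comm] at h3
  have h4 := hy hc
  simp only [mem_ofPred_eq] at h4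
  rw [Real.dist_eq, abs_sub_lt_iff]
  constructor <;> linarith

lemma exists_height : ∃ ρ : Z → ℝ, Continuous ρ ∧ ρ v = 0 ∧
    ∀ a b, R a b → a ≠ b → ρ a < ρ b := by
  have : Nonempty Z := ⟨v⟩
  let d := TopologicalSpace.denseSeq Z
  let F : ℕ → Z → ℝ := fun k z => (1 / 2) ^ k * Metric.infDist (d k) {x | R x z}
  have hbound : ∀ k z, F k z ≤ (1 / 2) ^ k * Metric.diam (univ : Set Z) := fun k z => by
    refine mul_le_mul_of_nonneg_left ?_ (by positivity)
    refine (Metric.infDist_le_dist_of_mem (show z ∈ {x | R x z} from h.refl z)).trans ?_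
    exact Metric.dist_le_diam_of_mem isCompact_univ.isBounded (mem_univ _) (mem_univ _)
  have hnonneg : ∀ k z, 0 ≤ F k z := fun k z =>
    mul_nonneg (by positivity) Metric.infDist_nonneg
  have hsum : Summable fun k : ℕ => (1 / 2 : ℝ) ^ k * Metric.diam (univ : Set Z) :=
    summable_geometric_two.mul_right _
  have hsumF : ∀ z, Summable fun k => F k z := fun z =>
    Summable.of_nonneg_of_le (fun k => hnonneg k z) (fun k => hbound k z) hsum
  have hcont : Continuous fun z => ∑' k, F k z :=
    continuous_tsum (fun k => continuous_const.mul (h.continuous_infDist_lower (d k))) hsum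
      fun k z => by rw [Real.norm_of_nonneg (hnonneg k z)]; exact hbound k z
  refine ⟨fun z => ∑' k, F k v - ∑' k, F k z, by fun_prop, by simp, fun a b hab hne => ?_⟩
  have hb : b ∉ {x | R x a} := fun hba => hne (h.antisymm hab hba)
  have hpos : 0 < Metric.infDist b {x | R x a} :=
    ((h.isClosed_lower a).notMem_iff_infDist_pos ⟨a, h.refl a⟩).mp hb
  obtain ⟨k, hk⟩ : ∃ k, dist b (d k) < Metric.infDist b {x | R x a} / 2 := by
    obtain ⟨y, hy, k, rfl⟩ := Metric.dense_iff.mp (TopologicalSpace.denseRange_denseSeq Z) b _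
      (half_pos hpos)
    refine ⟨k, ?_⟩
    rw [dist_comm]
    exact hy
  have hlt : F k b < F k a := by
    refine mul_lt_mul_of_pos_left ?_ (by positivity)
    have h1 := Metric.infDist_le_dist_of_mem (x := d k) (show b ∈ {x | R x b} from h.refl b)
    have h2 := Metric.infDist_le_infDist_add_dist (s := {x | R x a}) (x := b) (y := d k)
    rw [dist_comm] at h1
    linarith
  have := Summable.tsum_lt_tsum (f := fun k => F k b) (g := fun k => F k a) (i := k)
    (fun j => mul_le_mul_of_nonneg_left (Metric.infDist_le_infDist_of_subset
      (fun x hx => h.trans hx hab) ⟨a, h.refl a⟩) (by positivity)) hlt (hsumF b) (hsumF a)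
  linarith

end

end FanOrder

/-- `U` is relatively clopen in the complement of `v`. -/
structure IsRelClopen {Z : Type*} [TopologicalSpace Z] (v : Z) (U : Set Z) : Prop where
  isOpen : IsOpen U
  notMem : v ∉ U
  isClosed : IsClosed (insert v U)

namespace IsRelClopen

variable {Z : Type*} [TopologicalSpace Z] {v : Z} {U W : Set Z}

lemma ne (hU : IsRelClopen v U) {a : Z} (ha : a ∈ U) : a ≠ v := by
  rintro rfl
  exact hU.notMem ha

lemma compl_singleton [T1Space Z] (v : Z) : IsRelClopen v {v}ᶜ :=
  ⟨isOpen_compl_singleton, by simp, by simp [insert_eq]⟩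

lemma empty [T1Space Z] (v : Z) : IsRelClopen v (∅ : Set Z) :=
  ⟨isOpen_empty, by simp, by simp⟩

lemma diff (hU : IsRelClopen v U) (hW : IsRelClopen v W) : IsRelClopen v (U \ W) := by
  refine ⟨?_, fun hv => hU.notMem hv.1, ?_⟩
  · have : U \ W = U \ insert v W := by
      ext x
      refine ⟨fun hx => ⟨hx.1, ?_⟩, fun hx => ⟨hx.1, fun hxW => hx.2 (Or.inr hxW)⟩⟩
      rintro (rfl | hxW)
      exacts [hU.notMem hx.1, hx.2 hxW]
    rw [this]
    exact hU.isOpen.sdiff hW.isClosed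
  · have : insert v (U \ W) = insert v U \ W := by
      ext x
      constructor
      · rintro (rfl | hx)
        exacts [⟨Or.inl rfl, hW.notMem⟩, ⟨Or.inr hx.1, hx.2⟩]
      · rintro ⟨rfl | hx, hxW⟩
        exacts [Or.inl rfl, Or.inr ⟨hx, hxW⟩]
    rw [this]
    exact hU.isClosed.sdiff hW.isOpen

lemma inter (hU : IsRelClopen v U) (hW : IsRelClopen v W) : IsRelClopen v (U ∩ W) := by
  rw [← sdiff_sdiff_right_self]
  exact hU.diff (hU.diff hW)

end IsRelClopen

/-- A fan order together with a continuous strictly increasing height function. -/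
structure HeightFan {Z : Type*} [TopologicalSpace Z] (v : Z) (R : Z → Z → Prop) (ρ : Z → ℝ) : Prop
    extends FanOrder v R where
  cont : Continuous ρ
  zero : ρ v = 0
  strict : ∀ {a b}, R a b → a ≠ b → ρ a < ρ b

namespace HeightFan

variable {Z : Type*} [TopologicalSpace Z] {v : Z} {R : Z → Z → Prop} {ρ : Z → ℝ}
  (h : HeightFan v R ρ)
include h

lemma mono {a b : Z} (hab : R a b) : ρ a ≤ ρ b := by
  rcases eq_or_ne a b with rfl | hne
  · exact le_rfl
  · exact (h.strict hab hne).le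

lemma pos {a : Z} (ha : a ≠ v) : 0 < ρ a := by
  rw [← h.zero]
  exact h.strict (h.bot a) ha.symm

lemma nonneg (a : Z) : 0 ≤ ρ a := by
  rw [← h.zero]
  exact h.mono (h.bot a)

lemma ne_of_pos {a : Z} (ha : 0 < ρ a) : a ≠ v := by
  rintro rfl
  exact ha.ne' h.zero

lemma le_of_comp {a b : Z} (hab : R a b ∨ R b a) (hρ : ρ a ≤ ρ b) : R a b := by
  rcases hab with hab | hab
  · exact hab
  rcases eq_or_ne b a with rfl | hne
  · exact hab
  · exact absurd hρ (h.strict hab hne).not_ge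

lemma eq_of_comp {a b : Z} (hab : R a b ∨ R b a) (hρ : ρ a = ρ b) : a = b :=
  h.antisymm (h.le_of_comp hab hρ.le) (h.le_of_comp hab.symm hρ.ge)

lemma exists_level {z : Z} {s : ℝ} (hs : 0 ≤ s) (hsz : s ≤ ρ z) : ∃ a, R a z ∧ ρ a = s := by
  obtain ⟨a, ha, has⟩ := (h.conn z).intermediate_value (h.bot z) (h.refl z) h.cont.continuousOn
    (show s ∈ Icc (ρ v) (ρ z) from ⟨by rwa [h.zero], hsz⟩)
  exact ⟨a, ha, has⟩

lemma injOn_lower (z : Z) : InjOn ρ {x | R x z} :=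
  fun _ ha _ hb hab => h.eq_of_comp (h.chain ha hb) hab

lemma image_segment {a b : Z} (hab : R a b) : ρ '' {x | R a x ∧ R x b} = Icc (ρ a) (ρ b) := by
  ext s
  constructor
  · rintro ⟨x, ⟨hax, hxb⟩, rfl⟩
    exact ⟨h.mono hax, h.mono hxb⟩
  · rintro ⟨has, hsb⟩
    obtain ⟨x, hxb, rfl⟩ := h.exists_level ((h.nonneg a).trans has) hsb
    exact ⟨x, ⟨h.le_of_comp (h.chain hab hxb) has, hxb⟩, rfl⟩

lemma isPreconnected_segment [CompactSpace Z] {a b : Z} (hab : R a b) :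
    IsPreconnected {x | R a x ∧ R x b} :=
  (h.isClosed_lower b).isCompact.isPreconnected_of_image h.cont.continuousOn (h.injOn_lower b)
    (fun _ hx => hx.2) (by rw [h.image_segment hab]; exact isPreconnected_Icc)

lemma isClosed_segment (a b : Z) : IsClosed {x | R a x ∧ R x b} :=
  (h.isClosed_upper a).inter (h.isClosed_lower b)

lemma comp_of_le_of_le [CompactSpace Z] {a b c : Z} (ha : a ≠ v) (hab : R a b) (hac : R a c) :
    R b c ∨ R c b := by
  refine h.chain_of_isPreconnected ((h.isClosed_segment a b).union (h.isClosed_segment a c))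
    (IsPreconnected.union a ⟨h.refl a, hab⟩ ⟨h.refl a, hac⟩ (h.isPreconnected_segment hab)
      (h.isPreconnected_segment hac)) ?_ (Or.inl ⟨hab, h.refl b⟩) (Or.inr ⟨hac, h.refl c⟩)
  rintro (⟨hav, -⟩ | ⟨hav, -⟩) <;> exact ha (h.antisymm hav (h.bot a))

lemma comp_trans [CompactSpace Z] {a b c : Z} (hb : b ≠ v) (hab : R a b ∨ R b a)
    (hbc : R b c ∨ R c b) : R a c ∨ R c a := by
  rcases hab with hab | hab <;> rcases hbc with hbc | hbc
  · exact Or.inl (h.trans hab hbc)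
  · exact h.chain hab hbc
  · exact h.comp_of_le_of_le hb hab hbc
  · exact Or.inr (h.trans hbc hab)

lemma mem_of_segment_subset [CompactSpace Z] {a b : Z} (hab : R a b ∨ R b a) {C D : Set Z}
    (hC : IsClosed C) (hD : IsClosed D) (hCD : Disjoint C D) (ha : a ∈ C)
    (hsub : ∀ x, ρ a ≤ ρ x ∨ ρ b ≤ ρ x → x ∈ C ∪ D) : b ∈ C := by
  have key : ∀ {p q : Z}, R p q → (∀ x, ρ p ≤ ρ x → x ∈ C ∪ D) → (p ∈ C ↔ q ∈ C) := by
    intro p q hpq hs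
    have := isPreconnected_iff_subset_of_disjoint_closed.mp (h.isPreconnected_segment hpq) C D
      hC hD (fun x hx => hs x (h.mono hx.1)) (by rw [hCD.inter_eq, inter_empty])
    rcases this with hsub | hsub
    · exact iff_of_true (hsub ⟨h.refl p, hpq⟩) (hsub ⟨hpq, h.refl q⟩)
    · exact iff_of_false (disjoint_right.mp hCD (hsub ⟨h.refl p, hpq⟩))
        (disjoint_right.mp hCD (hsub ⟨hpq, h.refl q⟩))
  rcases hab with hab | hab
  · exact (key hab fun x hx => hsub x (Or.inl hx)).mp ha
  · exact (key hab fun x hx => hsub x (Or.inr hx)).mpr ha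

lemma saturated [CompactSpace Z] {U : Set Z} (hU : IsRelClopen v U) {a b : Z}
    (hab : R a b ∨ R b a) (hb : b ≠ v) (ha : a ∈ U) : b ∈ U := by
  have key : ∀ {p q : Z}, p ≠ v → R p q → (p ∈ U ↔ q ∈ U) := by
    intro p q hp hpq
    have hv : ∀ x ∈ {x | R p x ∧ R x q}, x ≠ v := by
      rintro _ ⟨hpx, -⟩ rfl
      exact hp (h.antisymm hpx (h.bot p))
    have := isPreconnected_iff_subset_of_disjoint.mp (h.isPreconnected_segment hpq) U
      (insert v U)ᶜ hU.isOpen hU.isClosed.isOpen_compl (fun x hx => by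
        by_cases hxU : x ∈ U
        · exact Or.inl hxU
        · exact Or.inr (by rintro (rfl | hx'); exacts [hv _ hx rfl, hxU hx']))
      (by
        rw [eq_empty_iff_forall_notMem]
        rintro x ⟨-, hxU, hx'⟩
        exact hx' (Or.inr hxU))
    rcases this with hsub | hsub
    · exact iff_of_true (hsub ⟨h.refl p, hpq⟩) (hsub ⟨hpq, h.refl q⟩)
    · exact iff_of_false (fun hpU => hsub ⟨h.refl p, hpq⟩ (Or.inr hpU))
        (fun hqU => hsub ⟨hpq, h.refl q⟩ (Or.inr hqU))
  rcases hab with hab | hab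
  · exact (key (hU.ne ha) hab).mp ha
  · exact (key hb hab).mpr ha

lemma exists_separation_step [CompactSpace Z] [T2Space Z] {A B : Set Z} {ε : ℝ} (hε : 0 < ε)
    (hA : IsClosed A) (hB : IsClosed B) (hAε : A ⊆ {x | ε ≤ ρ x}) (hBε : B ⊆ {x | ε ≤ ρ x})
    (hAB : ∀ a ∈ A, ∀ b ∈ B, ¬ (R a b ∨ R b a)) :
    ∃ C D, IsClosed C ∧ IsClosed D ∧ C ∪ D = {x | ε ≤ ρ x} ∧ Disjoint C D ∧ A ⊆ C ∧ B ⊆ D := by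
  have hK : IsClosed {x | ε ≤ ρ x} := isClosed_le continuous_const h.cont
  refine hK.isCompact.exists_isClosed_partition hA hB hAε hBε ?_
  intro Q hQK hQc hQ a ha b hb haQ hbQ
  refine hAB a ha b hb (h.chain_of_isPreconnected hQc hQ (fun hv => ?_) haQ hbQ)
  have : ε ≤ ρ v := hQK hv
  rw [h.zero] at this
  exact hε.not_ge this

lemma exists_isRelClopen_separating [CompactSpace Z] [T2Space Z] {A B : Set Z}
    (hA : IsClosed A) (hB : IsClosed B) (hvA : v ∉ A) (hvB : v ∉ B)
    (hAB : ∀ a ∈ A, ∀ b ∈ B, ¬ (R a b ∨ R b a)) :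
    ∃ U, IsRelClopen v U ∧ A ⊆ U ∧ Disjoint U B := by
  obtain ⟨ε, hε, hεAB⟩ : ∃ ε, 0 < ε ∧ ∀ x ∈ A ∪ B, ε ≤ ρ x := by
    have hv : ∀ x ∈ A ∪ B, 0 < ρ x := fun x hx => h.pos (by
      rintro rfl
      exact hx.elim hvA hvB)
    rcases (A ∪ B).eq_empty_or_nonempty with hemp | hne
    · exact ⟨1, one_pos, by simp [hemp]⟩
    · obtain ⟨x, hx, hmin⟩ := (hA.union hB).isCompact.exists_isMinOn hne h.cont.continuousOn
      exact ⟨ρ x, hv x hx, fun y hy => hmin hy⟩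
  let e : ℕ → ℝ := fun n => ε / (n + 1)
  have he : ∀ n, 0 < e n := fun n => by positivity
  have he_anti : ∀ n, e (n + 1) ≤ e n := fun n => by
    have : (0 : ℝ) < n + 1 := by positivity
    exact div_le_div_of_nonneg_left hε.le this (by push_cast; linarith)
  let P : ℕ → Set Z × Set Z → Prop := fun n p => IsClosed p.1 ∧ IsClosed p.2 ∧
    p.1 ∪ p.2 = {x | e n ≤ ρ x} ∧ Disjoint p.1 p.2
  have hstep : ∀ n p, P n p → ∃ q, P (n + 1) q ∧ p.1 ⊆ q.1 ∧ p.2 ⊆ q.2 := by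
    rintro n ⟨C, D⟩ ⟨hC, hD, hCD, hdis⟩
    have hCn : ∀ x, x ∈ C ∪ D ↔ e n ≤ ρ x := fun x => by
      rw [show C ∪ D = {x | e n ≤ ρ x} from hCD]; rfl
    obtain ⟨C', D', hC', hD', hCD', hdis', hCC, hDD⟩ := h.exists_separation_step (he (n + 1)) hC hD
      (fun x hx => (he_anti n).trans ((hCn x).mp (Or.inl hx)))
      (fun x hx => (he_anti n).trans ((hCn x).mp (Or.inr hx)))
      (fun a ha b hb hab => disjoint_left.mp hdis (h.mem_of_segment_subset hab hC hD hdis ha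
        (by
          rintro x (hx | hx)
          · exact (hCn x).mpr (((hCn a).mp (Or.inl ha)).trans hx)
          · exact (hCn x).mpr (((hCn b).mp (Or.inr hb)).trans hx))) hb)
    exact ⟨(C', D'), ⟨hC', hD', hCD', hdis'⟩, hCC, hDD⟩
  obtain ⟨C₀, D₀, hC₀, hD₀, hCD₀, hdis₀, hAC, hBD⟩ := h.exists_separation_step (he 0) hA hB
    (fun x hx => by simpa [e] using hεAB x (Or.inl hx))
    (fun x hx => by simpa [e] using hεAB x (Or.inr hx)) hAB
  choose! F hFP hF1 hF2 using hstep
  let S : ℕ → Set Z × Set Z := fun n => Nat.rec (C₀, D₀) (fun n p => F n p) n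
  have hS : ∀ n, P n (S n) := fun n => by
    induction n with
    | zero => exact ⟨hC₀, hD₀, hCD₀, hdis₀⟩
    | succ n ih => exact hFP n _ ih
  have hmono1 : Monotone fun n => (S n).1 := monotone_nat_of_le_succ fun n => hF1 n _ (hS n)
  have hmono2 : Monotone fun n => (S n).2 := monotone_nat_of_le_succ fun n => hF2 n _ (hS n)
  have hdisj : ∀ m n, Disjoint (S m).1 (S n).2 := fun m n =>
    (hS (max m n)).2.2.2.mono (hmono1 (le_max_left m n)) (hmono2 (le_max_right m n))
  have hcov : ∀ n x, e n ≤ ρ x → x ∈ (S n).1 ∨ x ∈ (S n).2 := fun n x hx => by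
    have : x ∈ (S n).1 ∪ (S n).2 := by rw [(hS n).2.2.1]; exact hx
    exact this
  have hlev : ∀ x, x ≠ v → ∃ n, e n < ρ x := fun x hx => by
    obtain ⟨n, hn⟩ := exists_nat_one_div_lt (div_pos (h.pos hx) hε)
    refine ⟨n, ?_⟩
    rw [lt_div_iff₀ hε] at hn
    calc e n = 1 / (n + 1) * ε := by simp only [e]; ring
      _ < ρ x := hn
  have hne1 : ∀ n x, x ∈ (S n).1 → x ≠ v := fun n x hx => h.ne_of_pos ((he n).trans_le (by
    have : x ∈ (S n).1 ∪ (S n).2 := Or.inl hx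
    rw [(hS n).2.2.1] at this
    exact this))
  have hne2 : ∀ n x, x ∈ (S n).2 → x ≠ v := fun n x hx => h.ne_of_pos ((he n).trans_le (by
    have : x ∈ (S n).1 ∪ (S n).2 := Or.inr hx
    rw [(hS n).2.2.1] at this
    exact this))
  have hopen1 : IsOpen (⋃ n, (S n).1) := by
    rw [isOpen_iff_mem_nhds]
    intro x hx
    obtain ⟨m, hm⟩ := mem_iUnion.mp hx
    obtain ⟨n, hn⟩ := hlev x (hne1 m x hm)
    filter_upwards [(isOpen_lt continuous_const h.cont).mem_nhds hn,
      (hS n).2.1.isOpen_compl.mem_nhds (disjoint_left.mp (hdisj m n) hm)] with y hy hy2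
    exact mem_iUnion.mpr ⟨n, (hcov n y (le_of_lt hy)).resolve_right hy2⟩
  have hopen2 : IsOpen (⋃ n, (S n).2) := by
    rw [isOpen_iff_mem_nhds]
    intro x hx
    obtain ⟨m, hm⟩ := mem_iUnion.mp hx
    obtain ⟨n, hn⟩ := hlev x (hne2 m x hm)
    filter_upwards [(isOpen_lt continuous_const h.cont).mem_nhds hn,
      (hS n).1.isOpen_compl.mem_nhds (disjoint_right.mp (hdisj n m) hm)] with y hy hy2
    exact mem_iUnion.mpr ⟨n, (hcov n y (le_of_lt hy)).resolve_left hy2⟩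
  refine ⟨⋃ n, (S n).1, ⟨hopen1, fun hv => ?_, ?_⟩, fun x hx => mem_iUnion.mpr ⟨0, hAC hx⟩, ?_⟩
  · obtain ⟨n, hn⟩ := mem_iUnion.mp hv
    exact hne1 n v hn rfl
  · have : insert v (⋃ n, (S n).1) = (⋃ n, (S n).2)ᶜ := by
      ext x
      constructor
      · rintro (rfl | hx) hx2
        · obtain ⟨n, hn⟩ := mem_iUnion.mp hx2
          exact hne2 n x hn rfl
        · obtain ⟨m, hm⟩ := mem_iUnion.mp hx
          obtain ⟨n, hn⟩ := mem_iUnion.mp hx2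
          exact disjoint_left.mp (hdisj m n) hm hn
      · intro hx
        by_cases hxv : x = v
        · exact Or.inl hxv
        · obtain ⟨n, hn⟩ := hlev x hxv
          exact Or.inr (mem_iUnion.mpr ⟨n, (hcov n x hn.le).resolve_right
            fun hx2 => hx (mem_iUnion.mpr ⟨n, hx2⟩)⟩)
    rw [this]
    exact hopen2.isClosed_compl
  · rw [disjoint_left]
    intro x hx hxB
    obtain ⟨m, hm⟩ := mem_iUnion.mp hx
    exact disjoint_left.mp (hdisj m 0) hm (hBD hxB)

lemma exists_isRelClopen_of_not_comp [CompactSpace Z] [T2Space Z] {a b : Z} (ha : a ≠ v)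
    (hb : b ≠ v) (hab : ¬ (R a b ∨ R b a)) : ∃ U, IsRelClopen v U ∧ a ∈ U ∧ b ∉ U := by
  obtain ⟨U, hU, haU, hbU⟩ := h.exists_isRelClopen_separating (A := {a}) (B := {b})
    isClosed_singleton isClosed_singleton (by simpa using ha.symm) (by simpa using hb.symm)
    (by rintro _ rfl _ rfl; exact hab)
  exact ⟨U, hU, haU rfl, fun hb' => disjoint_left.mp hbU hb' rfl⟩

lemma exists_separating_sequence [CompactSpace Z] [T2Space Z] [SecondCountableTopology Z] :
    ∃ E : ℕ → Set Z, (∀ n, IsRelClopen v (E n)) ∧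
      ∀ a b, a ≠ v → b ≠ v → (∀ n, a ∈ E n ↔ b ∈ E n) → R a b ∨ R b a := by
  let I := {U : Set Z | IsRelClopen v U}
  obtain ⟨T, hTI, hTc, hT⟩ := TopologicalSpace.isOpen_biUnion_countable I
    (fun U => U ×ˢ (insert v U)ᶜ)
    (fun U hU => hU.isOpen.prod hU.isClosed.isOpen_compl)
  obtain ⟨E, hE⟩ : ∃ E : ℕ → Set Z, insert ∅ T = range E :=
    (hTc.insert ∅).exists_eq_range (insert_nonempty _ _)
  refine ⟨E, fun n => ?_, fun a b ha hb hEab => ?_⟩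
  · have : E n ∈ insert ∅ T := hE ▸ mem_range_self n
    rcases this with h0 | hn
    · rw [h0]
      exact IsRelClopen.empty v
    · exact hTI hn
  · by_contra hab
    obtain ⟨U, hU, haU, hbU⟩ := h.exists_isRelClopen_of_not_comp ha hb hab
    have hmem : (a, b) ∈ ⋃ U ∈ I, U ×ˢ (insert v U)ᶜ :=
      mem_biUnion (show U ∈ I from hU) ⟨haU, by rintro (rfl | hb'); exacts [hb rfl, hbU hb']⟩
    rw [← hT] at hmem
    obtain ⟨W, hW, haW, hbW⟩ := mem_iUnion₂.mp hmem
    obtain ⟨n, rfl⟩ : W ∈ range E := hE ▸ Or.inr hW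
    exact hbW (Or.inr ((hEab n).mp haW))

end HeightFan

/-- The supremum of the height function over a set. -/
noncomputable def supHeight {Z : Type*} (ρ : Z → ℝ) (U : Set Z) : ℝ := sSup (ρ '' U)

namespace HeightFan

section
variable {Z : Type*} [TopologicalSpace Z] [CompactSpace Z] {v : Z} {R : Z → Z → Prop} {ρ : Z → ℝ}
  (h : HeightFan v R ρ)
include h

lemma isGreatest_supHeight {U : Set Z} (hU : IsRelClopen v U) (hne : U.Nonempty) :
    IsGreatest (ρ '' U) (supHeight ρ U) := by
  obtain ⟨p, hp, hmax⟩ := hU.isClosed.isCompact.exists_isMaxOn (insert_nonempty v U)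
    h.cont.continuousOn
  obtain ⟨x, hx⟩ := hne
  have hpU : p ∈ U := hp.resolve_left (h.ne_of_pos ((h.pos (hU.ne hx)).trans_le (hmax (Or.inr hx))))
  have hg : IsGreatest (ρ '' U) (ρ p) :=
    ⟨⟨p, hpU, rfl⟩, by rintro _ ⟨y, hy, rfl⟩; exact hmax (Or.inr hy)⟩
  rw [supHeight, hg.csSup_eq]
  exact hg

lemma exists_eq_supHeight {U : Set Z} (hU : IsRelClopen v U) (hne : U.Nonempty) :
    ∃ p ∈ U, ρ p = supHeight ρ U :=
  (h.isGreatest_supHeight hU hne).1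

lemma le_supHeight {U : Set Z} (hU : IsRelClopen v U) {a : Z} (ha : a ∈ U) :
    ρ a ≤ supHeight ρ U :=
  (h.isGreatest_supHeight hU ⟨a, ha⟩).2 ⟨a, ha, rfl⟩

lemma supHeight_pos {U : Set Z} (hU : IsRelClopen v U) (hne : U.Nonempty) :
    0 < supHeight ρ U := by
  obtain ⟨a, ha⟩ := hne
  exact (h.pos (hU.ne ha)).trans_le (h.le_supHeight hU ha)

lemma supHeight_mono {U W : Set Z} (hU : IsRelClopen v U) (hW : IsRelClopen v W)
    (hne : U.Nonempty) (hUW : U ⊆ W) : supHeight ρ U ≤ supHeight ρ W := by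
  obtain ⟨p, hp, hpU⟩ := h.exists_eq_supHeight hU hne
  rw [← hpU]
  exact h.le_supHeight hW (hUW hp)

lemma supHeight_inter_or_diff {A U : Set Z} (hA : IsRelClopen v A) (hU : IsRelClopen v U)
    (h1 : (A ∩ U).Nonempty) (h2 : (A \ U).Nonempty) :
    supHeight ρ (A ∩ U) = supHeight ρ A ∨ supHeight ρ (A \ U) = supHeight ρ A := by
  obtain ⟨p, hp, hpA⟩ := h.exists_eq_supHeight hA (h1.mono inter_subset_left)
  by_cases hpU : p ∈ U
  · left
    refine (h.supHeight_mono (hA.inter hU) hA h1 inter_subset_left).antisymm ?_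
    rw [← hpA]
    exact h.le_supHeight (hA.inter hU) ⟨hp, hpU⟩
  · right
    refine (h.supHeight_mono (hA.diff hU) hA h2 sdiff_subset).antisymm ?_
    rw [← hpA]
    exact h.le_supHeight (hA.diff hU) ⟨hp, hpU⟩

lemma exists_small_piece [T2Space Z] (hmax : Dense {e | ∀ y, R e y → y = e}) {B : Set Z}
    (hB : IsRelClopen v B) (hne : B.Nonempty) {t ε : ℝ} (ht : 0 < t) (htB : t ≤ supHeight ρ B)
    (hε : 0 < ε) :
    ∃ W, IsRelClopen v W ∧ W ⊆ B ∧ W.Nonempty ∧ (B \ W).Nonempty ∧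
      supHeight ρ (B \ W) = supHeight ρ B ∧
      |Real.log (supHeight ρ W) - Real.log t| ≤ ε := by
  obtain ⟨p, hp, hpB⟩ := h.exists_eq_supHeight hB hne
  have hlt : ∀ δ > 0, t * Real.exp (-δ) < t := fun δ hδ =>
    mul_lt_of_lt_one_right ht (Real.exp_lt_one_iff.mpr (by linarith))
  have hpos : ∀ δ, 0 < t * Real.exp (-δ) := fun δ => by positivity
  obtain ⟨q, hqp, hq⟩ := h.exists_level (hpos (ε / 2)).le
    (((hlt _ (half_pos hε)).le.trans htB).trans hpB.ge)
  have hqB : q ∈ B := h.saturated hB (Or.inr hqp) (h.ne_of_pos (hq ▸ hpos _)) hp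
  have hopen : IsOpen (B ∩ {x | t * Real.exp (-ε) < ρ x} ∩ {x | ρ x < t}) :=
    (hB.isOpen.inter (isOpen_lt continuous_const h.cont)).inter (isOpen_lt h.cont continuous_const)
  obtain ⟨e, ⟨⟨heB, heε⟩, het⟩, hemax⟩ := hmax.inter_open_nonempty _ hopen
    ⟨q, ⟨hqB, by
      change _ < ρ q
      rw [hq]
      exact mul_lt_mul_of_pos_left (Real.exp_lt_exp.mpr (by linarith)) ht⟩, by
      change ρ q < _
      rw [hq]
      exact hlt _ (half_pos hε)⟩
  change _ < ρ e at heε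
  change ρ e < t at het
  obtain ⟨U, hU, heU, hUF⟩ := h.exists_isRelClopen_separating (A := {e}) (B := {x | t ≤ ρ x})
    isClosed_singleton (isClosed_le continuous_const h.cont)
    (by simpa using (hB.ne heB).symm)
    (by
      intro hv
      have : t ≤ ρ v := hv
      rw [h.zero] at this
      exact ht.not_ge this)
    (by
      rintro _ rfl b hb (hab | hab)
      · rw [hemax b hab] at hb
        exact het.not_ge hb
      · exact (h.mono hab).not_gt (het.trans_le hb))
  have hpU : p ∉ U := fun hpU => disjoint_left.mp hUF hpU (htB.trans hpB.ge)
  have hW := hB.inter hU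
  have heW : e ∈ B ∩ U := ⟨heB, heU rfl⟩
  have hpW : p ∈ B \ (B ∩ U) := ⟨hp, fun hpW => hpU hpW.2⟩
  refine ⟨B ∩ U, hW, inter_subset_left, ⟨e, heW⟩, ⟨p, hpW⟩, ?_, ?_⟩
  · refine (h.supHeight_mono (hB.diff hW) hB ⟨p, hpW⟩ sdiff_subset).antisymm ?_
    rw [← hpB]
    exact h.le_supHeight (hB.diff hW) hpW
  · obtain ⟨m, hm, hmW⟩ := h.exists_eq_supHeight hW ⟨e, heW⟩
    have h1 : supHeight ρ (B ∩ U) < t := by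
      rw [← hmW]
      by_contra! hle
      exact disjoint_left.mp hUF hm.2 hle
    have h2 : t * Real.exp (-ε) < supHeight ρ (B ∩ U) := heε.trans_le (h.le_supHeight hW heW)
    have h3 := Real.log_lt_log (hpos ε) h2
    have h4 := Real.log_lt_log ((hpos ε).trans h2) h1
    rw [Real.log_mul ht.ne' (Real.exp_ne_zero _), Real.log_exp] at h3
    rw [abs_le]
    constructor <;> linarith

end

end HeightFan

section Matching

variable {Z Z' : Type*} [TopologicalSpace Z] [CompactSpace Z] [TopologicalSpace Z'] [CompactSpace Z']
  {v : Z} {R : Z → Z → Prop} {ρ : Z → ℝ} {v' : Z'} {R' : Z' → Z' → Prop} {ρ' : Z' → ℝ}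

lemma HeightFan.exists_matching_piece [T2Space Z'] (h : HeightFan v R ρ) (h' : HeightFan v' R' ρ')
    (hmax : Dense {e | ∀ y, R' e y → y = e}) {A U : Set Z} {B : Set Z'} (hA : IsRelClopen v A)
    (hU : IsRelClopen v U) (hB : IsRelClopen v' B) (hBne : B.Nonempty) {ε : ℝ} (hε : 0 < ε) :
    ∃ V, IsRelClopen v' V ∧ ((A ∩ U).Nonempty → (B ∩ V).Nonempty ∧
        |Real.log (supHeight ρ (A ∩ U)) - Real.log (supHeight ρ' (B ∩ V)) -
          (Real.log (supHeight ρ A) - Real.log (supHeight ρ' B))| ≤ ε) ∧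
      ((A \ U).Nonempty → (B \ V).Nonempty ∧
        |Real.log (supHeight ρ (A \ U)) - Real.log (supHeight ρ' (B \ V)) -
          (Real.log (supHeight ρ A) - Real.log (supHeight ρ' B))| ≤ ε) ∧
      ((B ∩ V).Nonempty → A.Nonempty → (A ∩ U).Nonempty) ∧
      ((B \ V).Nonempty → A.Nonempty → (A \ U).Nonempty) := by
  rcases (A ∩ U).eq_empty_or_nonempty with h1 | h1
  · have hAU : A \ U = A := by
      rw [sdiff_eq_left, disjoint_iff_inter_eq_empty, h1]
    refine ⟨∅, IsRelClopen.empty v', ?_, ?_, ?_, ?_⟩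
    · rw [h1]
      exact fun hne => absurd hne not_nonempty_empty
    · intro _
      rw [sdiff_empty, hAU, sub_self, abs_zero]
      exact ⟨hBne, hε.le⟩
    · rw [inter_empty]
      exact fun hne => absurd hne not_nonempty_empty
    · rw [hAU]
      exact fun _ hne => hne
  rcases (A \ U).eq_empty_or_nonempty with h2 | h2
  · have hAU : A ∩ U = A := inter_eq_left.mpr (sdiff_eq_empty.mp h2)
    refine ⟨B, hB, ?_, ?_, ?_, ?_⟩
    · intro _
      rw [inter_self, hAU, sub_self, abs_zero]
      exact ⟨hBne, hε.le⟩
    · rw [h2]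
      exact fun hne => absurd hne not_nonempty_empty
    · rw [hAU]
      exact fun _ hne => hne
    · rw [sdiff_self]
      exact fun hne => absurd hne not_nonempty_empty
  have hAne : A.Nonempty := h1.mono inter_subset_left
  have hApos := h.supHeight_pos hA hAne
  have hBpos := h'.supHeight_pos hB hBne
  have piece : ∀ A₁ ⊆ A, IsRelClopen v A₁ → A₁.Nonempty →
      ∃ W, IsRelClopen v' W ∧ W ⊆ B ∧ W.Nonempty ∧ (B \ W).Nonempty ∧
        supHeight ρ' (B \ W) = supHeight ρ' B ∧
        |Real.log (supHeight ρ A₁) - Real.log (supHeight ρ' W) -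
          (Real.log (supHeight ρ A) - Real.log (supHeight ρ' B))| ≤ ε := by
    intro A₁ hA₁A hA₁ hA₁ne
    have hpos := h.supHeight_pos hA₁ hA₁ne
    have hle := h.supHeight_mono hA₁ hA hA₁ne hA₁A
    obtain ⟨W, hW, hWB, hWne, hBW, hBWs, hlog⟩ := h'.exists_small_piece hmax hB hBne
      (t := supHeight ρ A₁ / supHeight ρ A * supHeight ρ' B) (by positivity)
      (mul_le_of_le_one_left hBpos.le ((div_le_one hApos).mpr hle)) hε
    refine ⟨W, hW, hWB, hWne, hBW, hBWs, ?_⟩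
    rw [Real.log_mul (by positivity) hBpos.ne', Real.log_div hpos.ne' hApos.ne'] at hlog
    rw [← abs_neg]
    convert hlog using 2
    ring
  rcases h.supHeight_inter_or_diff hA hU h1 h2 with hsup | hsup
  · obtain ⟨W, hW, hWB, hWne, hBW, hBWs, hlog⟩ := piece (A \ U) sdiff_subset (hA.diff hU) h2
    have e1 : B ∩ (B \ W) = B \ W := inter_eq_right.mpr sdiff_subset
    have e2 : B \ (B \ W) = W := sdiff_sdiff_cancel_left hWB
    refine ⟨B \ W, hB.diff hW, ?_, ?_, fun _ _ => h1, fun _ _ => h2⟩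
    · intro _
      rw [e1, hsup, hBWs, sub_self, abs_zero]
      exact ⟨hBW, hε.le⟩
    · intro _
      rw [e2]
      exact ⟨hWne, hlog⟩
  · obtain ⟨W, hW, hWB, hWne, hBW, hBWs, hlog⟩ := piece (A ∩ U) inter_subset_left (hA.inter hU) h1
    have e1 : B ∩ W = W := inter_eq_right.mpr hWB
    refine ⟨W, hW, ?_, ?_, fun _ _ => h1, fun _ _ => h2⟩
    · intro _
      rw [e1]
      exact ⟨hWne, hlog⟩
    · intro _
      rw [hsup, hBWs, sub_self, abs_zero]
      exact ⟨hBW, hε.le⟩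

end Matching

/-- A relation between two punctured spaces that matches the pieces of a partition of the one by
relatively clopen sets with the pieces of such a partition of the other. -/
structure CellMatching {Z Z' : Type*} [TopologicalSpace Z] [TopologicalSpace Z'] (v : Z) (v' : Z')
    (S : Z → Z' → Prop) : Prop where
  exists_left : ∀ {z'}, z' ≠ v' → ∃ z, S z z'
  exists_right : ∀ {z}, z ≠ v → ∃ z', S z z'
  left : ∀ z', IsRelClopen v {z | S z z'}
  right : ∀ z, IsRelClopen v' {z' | S z z'}
  difunctional : ∀ {a b c d}, S a b → S c b → S c d → S a d

/-- The logarithm of the ratio of the heights of two matched cells. -/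
noncomputable def logRatio {Z Z' : Type*} (ρ : Z → ℝ) (ρ' : Z' → ℝ) (S : Z → Z' → Prop)
    (z : Z) (z' : Z') : ℝ :=
  Real.log (supHeight ρ {a | S a z'}) - Real.log (supHeight ρ' {b | S z b})

lemma logRatio_flip {Z Z' : Type*} (ρ : Z → ℝ) (ρ' : Z' → ℝ) (S : Z → Z' → Prop)
    (z : Z) (z' : Z') : logRatio ρ' ρ (flip S) z' z = - logRatio ρ ρ' S z z' :=
  (neg_sub _ _).symm

namespace CellMatching

variable {Z Z' : Type*} [TopologicalSpace Z] [TopologicalSpace Z'] {v : Z} {v' : Z'}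
  {S : Z → Z' → Prop}

lemma top [T1Space Z] [T1Space Z'] [Nontrivial Z] [Nontrivial Z'] (v : Z) (v' : Z') :
    CellMatching v v' (fun z z' => z ≠ v ∧ z' ≠ v') where
  exists_left hz' := (exists_ne v).imp fun _ hz => ⟨hz, hz'⟩
  exists_right hz := (exists_ne v').imp fun _ hz' => ⟨hz, hz'⟩
  left z' := by
    by_cases hz' : z' = v'
    · simpa [hz'] using IsRelClopen.empty v
    · simpa [hz', compl_def] using IsRelClopen.compl_singleton v
  right z := by
    by_cases hz : z = v
    · simpa [hz] using IsRelClopen.empty v'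
    · simpa [hz, compl_def] using IsRelClopen.compl_singleton v'
  difunctional hab _ hcd := ⟨hab.1, hcd.2⟩

variable (hS : CellMatching v v' S)
include hS

lemma ne_left {z : Z} {z' : Z'} (hz : S z z') : z ≠ v := (hS.left z').ne hz

lemma ne_right {z : Z} {z' : Z'} (hz : S z z') : z' ≠ v' := (hS.right z).ne hz

lemma flip : CellMatching v' v (flip S) where
  exists_left := hS.exists_right
  exists_right := hS.exists_left
  left := hS.right
  right := hS.left
  difunctional hab hcb hcd := hS.difunctional hcd hcb hab

lemma right_eq {z a : Z} {z' : Z'} (hz : S z z') (ha : S a z') : {b | S a b} = {b | S z b} :=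
  Set.ext fun _ => ⟨fun hb => hS.difunctional hz ha hb, fun hb => hS.difunctional ha hz hb⟩

lemma left_eq {z : Z} {z' b : Z'} (hz : S z z') (hb : S z b) : {a | S a b} = {a | S a z'} :=
  Set.ext fun _ => ⟨fun ha => hS.difunctional ha hb hz, fun ha => hS.difunctional ha hz hb⟩

lemma exists_refinement [CompactSpace Z] [CompactSpace Z'] [T2Space Z'] {R : Z → Z → Prop}
    {ρ : Z → ℝ} {R' : Z' → Z' → Prop} {ρ' : Z' → ℝ} (h : HeightFan v R ρ) (h' : HeightFan v' R' ρ')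
    (hmax : Dense {e | ∀ y, R' e y → y = e}) {U : Set Z} (hU : IsRelClopen v U) {ε : ℝ}
    (hε : 0 < ε) :
    ∃ T, CellMatching v v' T ∧ (∀ z z', T z z' → S z z') ∧
      (∀ a b c, T a b → T c b → (a ∈ U ↔ c ∈ U)) ∧
      ∀ a b, T a b → |logRatio ρ ρ' T a b - logRatio ρ ρ' S a b| ≤ ε := by
  have key : ∀ (A : Set Z) (B : Set Z'), ∃ V, IsRelClopen v A → IsRelClopen v' B → B.Nonempty → _ :=
    fun A B => by
      by_cases hAB : IsRelClopen v A ∧ IsRelClopen v' B ∧ B.Nonempty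
      · exact (h.exists_matching_piece h' hmax hAB.1 hU hAB.2.1 hAB.2.2 hε).imp
          fun V hV _ _ _ => hV
      · exact ⟨∅, fun h1 h2 h3 => absurd ⟨h1, h2, h3⟩ hAB⟩
  choose V hV using key
  have spec : ∀ {z z'}, S z z' → _ := fun {z z'} hz =>
    hV {a | S a z'} {b | S z b} (hS.left z') (hS.right z) ⟨z', hz⟩
  let T : Z → Z' → Prop := fun z z' => S z z' ∧ (z ∈ U ↔ z' ∈ V {a | S a z'} {b | S z b})
  have hT : ∀ {z z' a b}, S z z' → S a z' → S z b →
      (T a b ↔ (a ∈ U ↔ b ∈ V {a | S a z'} {b | S z b})) := by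
    intro z z' a b hz ha hb
    have hab : S a b := hS.difunctional ha hz hb
    simp only [T, hab, true_and, hS.left_eq hz hb, hS.right_eq hz ha]
  have hTl : ∀ {z z'}, S z z' → {a | T a z'} =
      {a | S a z' ∧ (a ∈ U ↔ z' ∈ V {a | S a z'} {b | S z b})} := by
    intro z z' hz
    ext a
    exact ⟨fun ha => ⟨ha.1, (hT hz ha.1 hz).mp ha⟩, fun ha => (hT hz ha.1 hz).mpr ha.2⟩
  have hTr : ∀ {z z'}, S z z' → {b | T z b} =
      {b | S z b ∧ (z ∈ U ↔ b ∈ V {a | S a z'} {b | S z b})} := by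
    intro z z' hz
    ext b
    exact ⟨fun hb => ⟨hb.1, (hT hz hz hb.1).mp hb⟩, fun hb => (hT hz hz hb.1).mpr hb.2⟩
  have hlU : ∀ {z z'}, S z z' → z' ∈ V {a | S a z'} {b | S z b} →
      {a | T a z'} = {a | S a z'} ∩ U := by
    intro z z' hz hz'
    rw [hTl hz]
    ext a
    simp [hz']
  have hlU' : ∀ {z z'}, S z z' → z' ∉ V {a | S a z'} {b | S z b} →
      {a | T a z'} = {a | S a z'} \ U := by
    intro z z' hz hz'
    rw [hTl hz]
    ext a
    simp [hz']
  have hrU : ∀ {z z'}, S z z' → z ∈ U →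
      {b | T z b} = {b | S z b} ∩ V {a | S a z'} {b | S z b} := by
    intro z z' hz hz'
    rw [hTr hz]
    ext a
    simp [hz']
  have hrU' : ∀ {z z'}, S z z' → z ∉ U →
      {b | T z b} = {b | S z b} \ V {a | S a z'} {b | S z b} := by
    intro z z' hz hz'
    rw [hTr hz]
    ext a
    simp [hz']
  refine ⟨T, ⟨?_, ?_, ?_, ?_, ?_⟩, fun z z' hz => hz.1, ?_, ?_⟩
  · intro z' hz'
    obtain ⟨z, hz⟩ := hS.exists_left hz'
    obtain ⟨-, -, -, h3, h4⟩ := spec hz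
    change {a | T a z'}.Nonempty
    by_cases hzV : z' ∈ V {a | S a z'} {b | S z b}
    · rw [hlU hz hzV]
      exact h3 ⟨z', hz, hzV⟩ ⟨z, hz⟩
    · rw [hlU' hz hzV]
      exact h4 ⟨z', hz, hzV⟩ ⟨z, hz⟩
  · intro z hz
    obtain ⟨z', hz⟩ := hS.exists_right hz
    obtain ⟨-, h1, h2, -, -⟩ := spec hz
    change {b | T z b}.Nonempty
    by_cases hzU : z ∈ U
    · rw [hrU hz hzU]
      exact (h1 ⟨z, hz, hzU⟩).1
    · rw [hrU' hz hzU]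
      exact (h2 ⟨z, hz, hzU⟩).1
  · intro z'
    by_cases hne : ∃ z, S z z'
    · obtain ⟨z, hz⟩ := hne
      by_cases hzV : z' ∈ V {a | S a z'} {b | S z b}
      · rw [hlU hz hzV]
        exact (hS.left z').inter hU
      · rw [hlU' hz hzV]
        exact (hS.left z').diff hU
    · have : {z | T z z'} = {z | S z z'} :=
        Set.ext fun z => ⟨fun hz => hz.1, fun hz => absurd ⟨z, hz⟩ hne⟩
      rw [this]
      exact hS.left z'
  · intro z
    by_cases hne : ∃ z', S z z'
    · obtain ⟨z', hz⟩ := hne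
      by_cases hzU : z ∈ U
      · rw [hrU hz hzU]
        exact (hS.right z).inter (spec hz).1
      · rw [hrU' hz hzU]
        exact (hS.right z).diff (spec hz).1
    · have : {z' | T z z'} = {z' | S z z'} :=
        Set.ext fun z' => ⟨fun hz => hz.1, fun hz => absurd ⟨z', hz⟩ hne⟩
      rw [this]
      exact hS.right z
  · intro a b c d hab hcb hcd
    have hS' := hS.difunctional hab.1 hcb.1 hcd.1
    refine (hT hab.1 hab.1 hS').mpr ?_
    have h1 := (hT hab.1 hab.1 hab.1).mp hab
    have h2 := (hT hab.1 hcb.1 hab.1).mp hcb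
    have h3 := (hT hab.1 hcb.1 hS').mp hcd
    rw [h1, ← h2, h3]
  · intro a b c hab hcb
    rw [(hT hab.1 hab.1 hab.1).mp hab, (hT hab.1 hcb.1 hab.1).mp hcb]
  · intro a b hab
    obtain ⟨-, h1, h2, -, -⟩ := spec hab.1
    by_cases haU : a ∈ U
    · have hbV := ((hT hab.1 hab.1 hab.1).mp hab).mp haU
      rw [logRatio, logRatio, hlU hab.1 hbV, hrU hab.1 haU]
      exact (h1 ⟨a, hab.1, haU⟩).2
    · have hbV := fun hb => haU (((hT hab.1 hab.1 hab.1).mp hab).mpr hb)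
      rw [logRatio, logRatio, hlU' hab.1 hbV, hrU' hab.1 haU]
      exact (h2 ⟨a, hab.1, haU⟩).2

end CellMatching

/-- A sequence of matchings by finer and finer cells with controlled height ratios. -/
structure MatchingSequence {Z Z' : Type*} [TopologicalSpace Z] [TopologicalSpace Z'] (v : Z)
    (R : Z → Z → Prop) (ρ : Z → ℝ) (v' : Z') (R' : Z' → Z' → Prop) (ρ' : Z' → ℝ)
    (S : ℕ → Z → Z' → Prop) : Prop where
  zero : ∀ {z z'}, z ≠ v → z' ≠ v' → S 0 z z'
  matching : ∀ n, CellMatching v v' (S n)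
  anti : ∀ {n z z'}, S (n + 1) z z' → S n z z'
  comp_left : ∀ {a b c}, (∀ n, S n a b) → (∀ n, S n c b) → R a c ∨ R c a
  comp_right : ∀ {a b c}, (∀ n, S n a b) → (∀ n, S n a c) → R' b c ∨ R' c b
  logRatio_le : ∀ {n z z'}, S (n + 1) z z' →
    |logRatio ρ ρ' (S (n + 1)) z z' - logRatio ρ ρ' (S n) z z'| ≤ 2 / 2 / 2 ^ n

/-- The limit relation of a sequence of matchings. -/
def LimitMatch {Z Z' : Type*} (v : Z) (ρ : Z → ℝ) (v' : Z') (ρ' : Z' → ℝ)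
    (S : ℕ → Z → Z' → Prop) (z : Z) (z' : Z') : Prop :=
  (z = v ∧ z' = v') ∨
    ∀ n, S n z z' ∧ |Real.log (ρ z) - Real.log (ρ' z') - logRatio ρ ρ' (S n) z z'| ≤ 2 / 2 ^ n

lemma LimitMatch.flip {Z Z' : Type*} {v : Z} {ρ : Z → ℝ} {v' : Z'} {ρ' : Z' → ℝ}
    {S : ℕ → Z → Z' → Prop} {z : Z} {z' : Z'} (hz : LimitMatch v ρ v' ρ' S z z') :
    LimitMatch v' ρ' v ρ (fun n => flip (S n)) z' z := by
  refine hz.imp And.symm fun hz n => ⟨(hz n).1, ?_⟩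
  rw [logRatio_flip, ← abs_neg]
  convert (hz n).2 using 2
  ring

section Construction

variable {Z Z' : Type*} [TopologicalSpace Z] [CompactSpace Z] [T2Space Z]
  [SecondCountableTopology Z] [Nontrivial Z] [TopologicalSpace Z'] [CompactSpace Z'] [T2Space Z']
  [SecondCountableTopology Z'] [Nontrivial Z'] {v : Z} {R : Z → Z → Prop}
  {ρ : Z → ℝ} {v' : Z'} {R' : Z' → Z' → Prop} {ρ' : Z' → ℝ}

lemma exists_matchingSequence (h : HeightFan v R ρ) (h' : HeightFan v' R' ρ')
    (hmax : Dense {e | ∀ y, R e y → y = e}) (hmax' : Dense {e | ∀ y, R' e y → y = e}) :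
    ∃ S, MatchingSequence v R ρ v' R' ρ' S := by
  obtain ⟨E, hE, hEsep⟩ := h.exists_separating_sequence
  obtain ⟨E', hE', hEsep'⟩ := h'.exists_separating_sequence
  have step : ∀ (n : ℕ) (S : {S : Z → Z' → Prop // CellMatching v v' S}),
      ∃ T : {S : Z → Z' → Prop // CellMatching v v' S}, (∀ z z', T.1 z z' → S.1 z z') ∧
        (∀ a b c, T.1 a b → T.1 c b → (a ∈ E n ↔ c ∈ E n)) ∧
        (∀ a b c, T.1 a b → T.1 a c → (b ∈ E' n ↔ c ∈ E' n)) ∧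
        ∀ z z', T.1 z z' → |logRatio ρ ρ' T.1 z z' - logRatio ρ ρ' S.1 z z'| ≤ 2 / 2 / 2 ^ n := by
    rintro n ⟨S, hS⟩
    have hpos : (0 : ℝ) < 1 / 2 / 2 ^ n := by positivity
    obtain ⟨T, hT, hTS, hTE, hTq⟩ := hS.exists_refinement h h' hmax' (hE n) hpos
    obtain ⟨W, hW, hWT, hWE, hWq⟩ := hT.flip.exists_refinement h' h hmax (hE' n) hpos
    refine ⟨⟨flip W, hW.flip⟩, fun z z' hz => hTS z z' (hWT z' z hz),
      fun a b c ha hc => hTE a b c (hWT b a ha) (hWT b c hc),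
      fun a b c hb hc => hWE b a c hb hc, fun z z' hz => ?_⟩
    have h1 := hTq z z' (hWT z' z hz)
    have h2 := hWq z' z hz
    rw [logRatio_flip ρ ρ' T, ← neg_neg (logRatio ρ' ρ W z' z), ← logRatio_flip ρ' ρ W] at h2
    have h3 : (2 : ℝ) / 2 / 2 ^ n = 1 / 2 / 2 ^ n + 1 / 2 / 2 ^ n := by ring
    rw [h3]
    rw [abs_le] at h1 h2 ⊢
    constructor <;> linarith
  choose F hF using step
  let S : ℕ → {S : Z → Z' → Prop // CellMatching v v' S} :=
    fun n => Nat.rec ⟨_, CellMatching.top v v'⟩ F n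
  have hS : ∀ n, S (n + 1) = F n (S n) := fun n => rfl
  refine ⟨fun n => (S n).1, fun hz hz' => ⟨hz, hz'⟩, fun n => (S n).2, fun {n} _ _ hz => ?_, ?_, ?_, ?_⟩
  · exact (hF n (S n)).1 _ _ hz
  · intro a b c ha hc
    refine hEsep a c ((S 0).2.ne_left (ha 0)) ((S 0).2.ne_left (hc 0)) fun n => ?_
    exact (hF n (S n)).2.1 a b c (ha (n + 1)) (hc (n + 1))
  · intro a b c hb hc
    refine hEsep' b c ((S 0).2.ne_right (hb 0)) ((S 0).2.ne_right (hc 0)) fun n => ?_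
    exact (hF n (S n)).2.2.1 a b c (hb (n + 1)) (hc (n + 1))
  · intro n z z' hz
    exact (hF n (S n)).2.2.2 z z' hz

end Construction

namespace MatchingSequence

variable {Z Z' : Type*} [TopologicalSpace Z] [TopologicalSpace Z'] {v : Z} {R : Z → Z → Prop}
  {ρ : Z → ℝ} {v' : Z'} {R' : Z' → Z' → Prop} {ρ' : Z' → ℝ} {S : ℕ → Z → Z' → Prop}
  (hS : MatchingSequence v R ρ v' R' ρ' S)
include hS

lemma flip : MatchingSequence v' R' ρ' v R ρ (fun n => flip (S n)) where
  zero hz hz' := hS.zero hz' hz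
  matching n := (hS.matching n).flip
  anti hz := hS.anti hz
  comp_left := hS.comp_right
  comp_right := hS.comp_left
  logRatio_le {n z z'} hz := by
    rw [logRatio_flip, logRatio_flip, ← abs_neg]
    convert hS.logRatio_le hz using 2
    ring

lemma logRatio_congr {n : ℕ} {z : Z} {z' a : Z'} (hz : S n z z') (ha : S n z a) :
    logRatio ρ ρ' (S n) z a = logRatio ρ ρ' (S n) z z' := by
  rw [logRatio, logRatio, (hS.matching n).left_eq hz ha]

lemma logRatio_congr' {n : ℕ} {z a : Z} {z' : Z'} (hz : S n z z') (ha : S n a z') :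
    logRatio ρ ρ' (S n) a z' = logRatio ρ ρ' (S n) z z' := by
  rw [logRatio, logRatio, (hS.matching n).right_eq hz ha]

lemma exists_limitMatch [CompactSpace Z] [CompactSpace Z'] [FirstCountableTopology Z'] 
    (h : HeightFan v R ρ) (h' : HeightFan v' R' ρ') (z : Z) :
    ∃ z', LimitMatch v ρ v' ρ' S z z' := by
  rcases eq_or_ne z v with rfl | hz
  · exact ⟨v', Or.inl ⟨rfl, rfl⟩⟩
  choose p hp using fun n => (hS.matching n).exists_right hz
  obtain ⟨c, hc⟩ := cauchySeq_tendsto_of_complete (cauchySeq_of_le_geometric_two (C := 2)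
    (f := fun n => logRatio ρ ρ' (S n) z (p n)) (fun n => by
      rw [dist_comm, Real.dist_eq, ← hS.logRatio_congr (hp n) (hS.anti (hp (n + 1)))]
      exact hS.logRatio_le (hp (n + 1))))
  have hcn : ∀ n, dist (logRatio ρ ρ' (S n) z (p n)) c ≤ 2 / 2 ^ n := by
    refine dist_le_of_le_geometric_two_of_tendsto (fun n => ?_) hc
    rw [dist_comm, Real.dist_eq, ← hS.logRatio_congr (hp n) (hS.anti (hp (n + 1)))]
    exact hS.logRatio_le (hp (n + 1))
  have hlevel : ∀ n, ∃ b, S n z b ∧ ρ' b = ρ z * Real.exp (-logRatio ρ ρ' (S n) z (p n)) := by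
    intro n
    have hr := (hS.matching n).right z
    have hl := (hS.matching n).left (p n)
    obtain ⟨q, hq, hqs⟩ := h'.exists_eq_supHeight hr ⟨p n, hp n⟩
    have hle : ρ z * Real.exp (-logRatio ρ ρ' (S n) z (p n)) ≤ ρ' q := by
      rw [hqs, logRatio, neg_sub, Real.exp_sub, Real.exp_log (h'.supHeight_pos hr ⟨_, hp n⟩),
        Real.exp_log (h.supHeight_pos hl ⟨_, hp n⟩), mul_div_left_comm]
      exact mul_le_of_le_one_right (h'.supHeight_pos hr ⟨_, hp n⟩).le
        ((div_le_one (h.supHeight_pos hl ⟨_, hp n⟩)).mpr (h.le_supHeight hl (hp n)))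
    have hpos : 0 < ρ z * Real.exp (-logRatio ρ ρ' (S n) z (p n)) :=
      mul_pos (h.pos hz) (Real.exp_pos _)
    obtain ⟨b, hbq, hb⟩ := h'.exists_level hpos.le hle
    exact ⟨b, h'.saturated hr (Or.inr hbq) (h'.ne_of_pos (hb ▸ hpos)) hq, hb⟩
  choose b hb hbt using hlevel
  obtain ⟨z', -, φ, hφ, hlim⟩ := isCompact_univ.isSeqCompact (x := b) (fun _ => mem_univ _)
  have hz't : ρ' z' = ρ z * Real.exp (-c) := by
    refine tendsto_nhds_unique (h'.cont.continuousAt.tendsto.comp hlim) ?_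
    have : Tendsto (fun n => ρ z * Real.exp (-logRatio ρ ρ' (S n) z (p n))) atTop
        (𝓝 (ρ z * Real.exp (-c))) :=
      tendsto_const_nhds.mul ((Real.continuous_exp.tendsto _).comp hc.neg)
    refine (this.comp hφ.tendsto_atTop).congr fun n => (hbt (φ n)).symm
  have hz'v : z' ≠ v' := h'.ne_of_pos (hz't ▸ mul_pos (h.pos hz) (Real.exp_pos _))
  have hanti : ∀ {n m}, n ≤ m → ∀ {z'}, S m z z' → S n z z' := by
    intro n m hnm
    induction hnm with
    | refl => exact fun hz => hz
    | step _ ih => exact fun hz => ih (hS.anti hz)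
  refine ⟨z', Or.inr fun n => ?_⟩
  have hzn : S n z z' := by
    refine ((((hS.matching n).right z).isClosed.mem_of_tendsto hlim ?_).resolve_left hz'v)
    filter_upwards [hφ.tendsto_atTop.eventually_ge_atTop n] with m hm
    exact Or.inr (hanti hm (hb (φ m)))
  refine ⟨hzn, ?_⟩
  rw [hz't, Real.log_mul (h.pos hz).ne' (Real.exp_ne_zero _), Real.log_exp,
    hS.logRatio_congr (hp n) hzn]
  have := hcn n
  rw [dist_comm, Real.dist_eq] at this
  convert this using 2
  ring

lemma limitMatch_unique (h' : HeightFan v' R' ρ') {z : Z} {a b : Z'}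
    (ha : LimitMatch v ρ v' ρ' S z a) (hb : LimitMatch v ρ v' ρ' S z b) : a = b := by
  rcases ha with ⟨hz, rfl⟩ | ha <;> rcases hb with ⟨hz', rfl⟩ | hb
  · rfl
  · exact absurd hz ((hS.matching 0).ne_left (hb 0).1)
  · exact absurd hz' ((hS.matching 0).ne_left (ha 0).1)
  refine h'.eq_of_comp (hS.comp_right (fun n => (ha n).1) fun n => (hb n).1) ?_
  refine Real.log_injOn_pos (h'.pos ((hS.matching 0).ne_right (ha 0).1))
    (h'.pos ((hS.matching 0).ne_right (hb 0).1)) ?_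
  have key : ∀ n : ℕ, |Real.log (ρ' a) - Real.log (ρ' b)| ≤ 4 / 2 ^ n := by
    intro n
    have h1 := (ha n).2
    have h2 := (hb n).2
    rw [hS.logRatio_congr (ha n).1 (hb n).1] at h2
    have h3 : (4 : ℝ) / 2 ^ n = 2 / 2 ^ n + 2 / 2 ^ n := by ring
    rw [h3]
    rw [abs_le] at h1 h2 ⊢
    constructor <;> linarith
  have hlim : Tendsto (fun n : ℕ => (4 : ℝ) / 2 ^ n) atTop (𝓝 0) :=
    tendsto_const_nhds.div_atTop (tendsto_pow_atTop_atTop_of_one_lt one_lt_two)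
  have := ge_of_tendsto' hlim key
  exact sub_eq_zero.mp (abs_eq_zero.mp (this.antisymm (abs_nonneg _)))

lemma exists_height_le (h : HeightFan v R ρ) (h' : HeightFan v' R' ρ') : 
    ∃ K : ℝ, ∀ z z', LimitMatch v ρ v' ρ' S z z' → ρ' z' ≤ K * ρ z := by
  by_cases hne : ∃ z z', S 0 z z'
  · obtain ⟨a, b, hab⟩ := hne
    refine ⟨Real.exp (2 - logRatio ρ ρ' (S 0) a b), ?_⟩
    rintro z z' (⟨rfl, rfl⟩ | hz)
    · simp [h.zero, h'.zero]
    have hz0 := hz 0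
    have hm := hS.matching 0
    have hzb : S 0 z b := hS.zero (hm.ne_left hz0.1) (hm.ne_right hab)
    rw [hS.logRatio_congr hzb hz0.1, hS.logRatio_congr' hab hzb] at hz0
    have hρ := h.pos (hm.ne_left hz0.1)
    have hρ' := h'.pos (hm.ne_right hz0.1)
    rw [← Real.log_le_log_iff hρ' (by positivity), Real.log_mul (Real.exp_ne_zero _) hρ.ne',
      Real.log_exp]
    have := (abs_le.mp hz0.2).1
    norm_num at this
    linarith
  · refine ⟨1, ?_⟩
    rintro z z' (⟨rfl, rfl⟩ | hz)
    · simp [h.zero, h'.zero]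
    · exact absurd ⟨z, z', (hz 0).1⟩ hne

lemma isClosed_limitMatch (h : HeightFan v R ρ) (h' : HeightFan v' R' ρ') :
    IsClosed {p : Z × Z' | LimitMatch v ρ v' ρ' S p.1 p.2} := by
  rw [isClosed_iff_frequently]
  rintro ⟨z, z'⟩ hz
  have hc : Tendsto (fun p : Z × Z' => ρ p.1) (𝓝 (z, z')) (𝓝 (ρ z)) :=
    (h.cont.comp continuous_fst).tendsto (z, z')
  have hc' : Tendsto (fun p : Z × Z' => ρ' p.2) (𝓝 (z, z')) (𝓝 (ρ' z')) :=
    (h'.cont.comp continuous_snd).tendsto (z, z')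
  obtain ⟨K, hK⟩ := hS.exists_height_le h h'
  obtain ⟨K', hK'⟩ := hS.flip.exists_height_le h' h
  have h1 : ρ' z' ≤ K * ρ z := le_of_tendsto_of_tendsto_of_frequently hc'
    (tendsto_const_nhds.mul hc) (hz.mono fun p hp => hK p.1 p.2 hp)
  have h2 : ρ z ≤ K' * ρ' z' := le_of_tendsto_of_tendsto_of_frequently hc
    (tendsto_const_nhds.mul hc') (hz.mono fun p hp => hK' p.2 p.1 hp.flip)
  by_cases hzv : z = v
  · rw [hzv, h.zero, mul_zero] at h1
    exact Or.inl ⟨hzv, by_contra fun hz' => h1.not_gt (h'.pos hz')⟩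
  by_cases hzv' : z' = v'
  · rw [hzv', h'.zero, mul_zero] at h2
    exact absurd (h.pos hzv) h2.not_gt
  refine Or.inr fun n => ?_
  have hm := hS.matching n
  obtain ⟨q, hq⟩ := hm.exists_right hzv
  obtain ⟨p, hp⟩ := hm.exists_left hzv'
  have hev : ∀ᶠ x : Z × Z' in 𝓝 (z, z'), S n x.1 q ∧ S n p x.2 :=
    (((hm.left q).isOpen.preimage continuous_fst).inter
      ((hm.right p).isOpen.preimage continuous_snd)).mem_nhds ⟨hq, hp⟩
  have hfr : ∃ᶠ x : Z × Z' in 𝓝 (z, z'), S n z z' ∧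
      |Real.log (ρ x.1) - Real.log (ρ' x.2) - logRatio ρ ρ' (S n) z z'| ≤ 2 / 2 ^ n := by
    refine (hz.and_eventually hev).mono ?_
    rintro ⟨a, b⟩ ⟨hab | hab, haq, hpb⟩
    · exact absurd hab.1 (hm.ne_left haq)
    have hab := hab n
    have hzb : S n z b := hm.difunctional hq haq hab.1
    have hzz : S n z z' := hm.difunctional hzb hpb hp
    refine ⟨hzz, ?_⟩
    rw [hS.logRatio_congr hzb hzz, ← hS.logRatio_congr' hzb hab.1]
    exact hab.2
  obtain ⟨_, hzz, -⟩ := hfr.exists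
  exact ⟨hzz, le_of_tendsto_of_frequently
    (((hc.log (h.pos hzv).ne').sub (hc'.log (h'.pos hzv').ne')).sub tendsto_const_nhds).abs
    (hfr.mono fun _ hx => hx.2)⟩

end MatchingSequence

lemma continuous_of_isClosed_graph {Z Z' : Type*} [TopologicalSpace Z] [T2Space Z] [CompactSpace Z]
    [TopologicalSpace Z'] [CompactSpace Z'] {g : Z → Z'}
    (hg : IsClosed {p : Z × Z' | g p.1 = p.2}) : Continuous g := by
  refine continuous_iff_isClosed.mpr fun C hC => ?_
  have : g ⁻¹' C = Prod.fst '' ({p : Z × Z' | g p.1 = p.2} ∩ Prod.snd ⁻¹' C) := by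
    ext z
    constructor
    · exact fun hz => ⟨(z, g z), ⟨rfl, hz⟩, rfl⟩
    · rintro ⟨⟨a, b⟩, ⟨hab, hb⟩, rfl⟩
      change g a ∈ C
      rw [show g a = b from hab]
      exact hb
  rw [this]
  exact isClosedMap_fst_of_compactSpace _ (hg.inter (hC.preimage continuous_snd))

/-- Two compact fans with continuous heights and dense sets of maximal elements are
homeomorphic. -/
theorem HeightFan.nonempty_homeomorph {Z Z' : Type*} [TopologicalSpace Z] [CompactSpace Z]
    [T2Space Z] [SecondCountableTopology Z] [Nontrivial Z] [TopologicalSpace Z'] [CompactSpace Z']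
    [T2Space Z'] [SecondCountableTopology Z'] [Nontrivial Z'] {v : Z} {R : Z → Z → Prop}
    {ρ : Z → ℝ} {v' : Z'} {R' : Z' → Z' → Prop} {ρ' : Z' → ℝ} (h : HeightFan v R ρ)
    (h' : HeightFan v' R' ρ') (hmax : Dense {e | ∀ y, R e y → y = e})
    (hmax' : Dense {e | ∀ y, R' e y → y = e}) : Nonempty (Z ≃ₜ Z') := by
  obtain ⟨S, hS⟩ := exists_matchingSequence h h' hmax hmax'
  choose g hg using hS.exists_limitMatch h h'
  choose k hk using hS.flip.exists_limitMatch h' h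
  have hgk : ∀ z', g (k z') = z' := fun z' => hS.limitMatch_unique h' (hg _) (hk z').flip
  have hkg : ∀ z, k (g z) = z := fun z => hS.flip.limitMatch_unique h (hk _) (hg z).flip
  have hcont : Continuous g := by
    refine continuous_of_isClosed_graph ?_
    convert hS.isClosed_limitMatch h h' using 2
    ext p
    exact ⟨fun hp => hp ▸ hg p.1, fun hp => hS.limitMatch_unique h' (hg _) hp⟩
  exact ⟨Continuous.homeoOfEquivCompactToT2 (f := ⟨g, k, hkg, hgk⟩) hcont⟩

/-- `γ` restricts to an injective parametrization of `A` by the unit interval, from `x` to `y`. -/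
structure IsArcParam {X : Type*} [TopologicalSpace X] (γ : ℝ → X) (A : Set X) (x y : X) : Prop where
  cont : Continuous γ
  injOn : InjOn γ (Icc 0 1)
  image : γ '' Icc 0 1 = A
  zero : γ 0 = x
  one : γ 1 = y

section
variable {X : Type*} [TopologicalSpace X]

lemma IsEndpointOfArc.eq_or_eq {A : Set X} {x : X} (hx : IsEndpointOfArc A x)
    (φ : Icc (0 : ℝ) 1 ≃ₜ A) : x = φ 0 ∨ x = φ 1 := by
  obtain ⟨ψ, rfl⟩ := hx
  have hψ : (⟨0, by norm_num⟩ : Icc (0 : ℝ) 1) = 0 := rfl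
  rw [hψ]
  let g := ψ.trans φ.symm
  have hg : φ (g 0) = ψ 0 := φ.apply_symm_apply _
  rcases g.continuous.strictMono_of_inj_boundedOrder' g.injective with hm | hm
  · left
    obtain ⟨s, hs⟩ := g.surjective 0
    have : g 0 = 0 := le_antisymm ((hm.monotone (show 0 ≤ s from s.2.1)).trans_eq hs) (g 0).2.1
    rw [← hg, this]
  · right
    obtain ⟨s, hs⟩ := g.surjective 1
    have : g 0 = 1 := le_antisymm (g 0).2.2 (hs.ge.trans (hm.antitone (show 0 ≤ s from s.2.1)))
    rw [← hg, this]

lemma exists_isArcParam {A : Set X} {x y : X} (hx : IsEndpointOfArc A x) (hy : IsEndpointOfArc A y)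
    (hxy : x ≠ y) : ∃ γ, IsArcParam γ A x y := by
  obtain ⟨φ, hφ⟩ := hx
  have h0 : (φ 0 : X) = x := hφ
  have h1 : (φ 1 : X) = y := by
    rcases hy.eq_or_eq φ with h | h
    · exact absurd (h0.symm.trans h.symm) hxy
    · exact h.symm
  have hp : ∀ t : Icc (0 : ℝ) 1, projIcc 0 1 zero_le_one (t : ℝ) = t := projIcc_val zero_le_one
  refine ⟨fun t => φ (projIcc 0 1 zero_le_one t), ?_, ?_, ?_, ?_, ?_⟩
  · exact continuous_subtype_val.comp (φ.continuous.comp continuous_projIcc)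
  · intro s hs t ht hst
    have := φ.injective (Subtype.val_injective hst)
    rw [hp ⟨s, hs⟩, hp ⟨t, ht⟩] at this
    exact congrArg Subtype.val this
  · ext a
    constructor
    · rintro ⟨t, -, rfl⟩
      exact (φ _).2
    · intro ha
      obtain ⟨t, ht⟩ := φ.surjective ⟨a, ha⟩
      refine ⟨t, t.2, ?_⟩
      simp only [hp, ht]
  · simpa using h0
  · simpa using h1

namespace IsArcParam

variable {γ : ℝ → X} {A : Set X} {x y : X} (hγ : IsArcParam γ A x y)
include hγ

lemma isSubcontinuum_image {s t : ℝ} (hst : s ≤ t) : IsSubcontinuum (γ '' Icc s t) :=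
  ⟨isCompact_Icc.image hγ.cont, (isConnected_Icc hst).image _ hγ.cont.continuousOn⟩

lemma isSubcontinuum : IsSubcontinuum A := hγ.image ▸ hγ.isSubcontinuum_image zero_le_one

lemma ordConnected_preimage [T2Space X]
    (hX : ∀ A : Set X, IsSubcontinuum A → IsUnicoherent A) {Q : Set X} (hQ : IsSubcontinuum Q) :
    (Icc 0 1 ∩ γ ⁻¹' Q).OrdConnected := by
  rcases (Icc 0 1 ∩ γ ⁻¹' Q).eq_empty_or_nonempty with he | ⟨r, hr, hrQ⟩
  · rw [he]
    exact ordConnected_empty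
  refine IsPreconnected.ordConnected ?_
  have hA := hγ.isSubcontinuum
  have hrA : γ r ∈ A ∩ Q := ⟨hγ.image ▸ mem_image_of_mem γ hr, hrQ⟩
  have hconn := hX (A ∪ Q) ⟨hA.1.union hQ.1, hA.2.union ⟨_, hrA⟩ hQ.2⟩ A Q hA hQ rfl
  refine isCompact_Icc.isPreconnected_of_image hγ.cont.continuousOn hγ.injOn inter_subset_left ?_
  rw [image_inter_preimage, hγ.image]
  exact hconn.isPreconnected

end IsArcParam

lemma isSimpleTriodWithTop_of_injective {τ : ℝ × ℝ → X} [T2Space X] (hc : ContinuousOn τ triodModel)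
    (hi : InjOn τ triodModel) : IsSimpleTriodWithTop (τ '' triodModel) (τ (0, 0)) := by
  have : CompactSpace triodModel := isCompact_iff_compactSpace.mp
    ((isCompact_Icc.prod isCompact_singleton).union (isCompact_singleton.prod isCompact_Icc))
  exact ⟨Continuous.homeoOfEquivCompactToT2 (f := Equiv.Set.imageOfInjOn τ triodModel hi)
    (hc.domRestrict.subtype_mk _), rfl⟩

lemma exists_isSimpleTriodWithTop [T2Space X] {γ δ : ℝ → X} {A B : Set X} {x y x' y' : X}
    (hγ : IsArcParam γ A x y) (hδ : IsArcParam δ B x' y') {s t : ℝ} (hs : s ∈ Ioo (0 : ℝ) 1)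
    (ht : t ∈ Ico (0 : ℝ) 1) (hst : γ s = δ t)
    (hdisj : ∀ u ∈ Icc (0 : ℝ) 1, ∀ r ∈ Ioc t 1, γ u ≠ δ r) :
    ∃ T, IsSimpleTriodWithTop T (γ s) := by
  let p : ℝ → ℝ := fun a => s + max a 0 * (1 - s) + min a 0 * s
  let q : ℝ → ℝ := fun b => t + b * (1 - t)
  let τ : ℝ × ℝ → X := fun z => if z.2 = 0 then γ (p z.1) else δ (q z.2)
  have hp0 : p 0 = s := by simp [p]
  have hpI : ∀ a ∈ Icc (-1 : ℝ) 1, p a ∈ Icc (0 : ℝ) 1 := by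
    rintro a ⟨ha1, ha2⟩
    simp only [p]
    rcases le_total a 0 with ha | ha
    · rw [max_eq_right ha, min_eq_left ha]
      constructor <;> nlinarith [hs.1, hs.2]
    · rw [max_eq_left ha, min_eq_right ha]
      constructor <;> nlinarith [hs.1, hs.2]
  have hpm : StrictMono p := by
    intro a b hab
    simp only [p]
    rcases (max_le_max hab.le le_rfl : max a 0 ≤ max b 0).eq_or_lt with h1 | h1
    · rcases (min_le_min hab.le le_rfl : min a 0 ≤ min b 0).eq_or_lt with h2 | h2
      · linarith [max_add_min a 0, max_add_min b 0]
      · nlinarith [hs.1]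
    · nlinarith [hs.1, hs.2, (min_le_min hab.le le_rfl : min a 0 ≤ min b 0)]
  have hqI : ∀ b ∈ Ioc (0 : ℝ) 1, q b ∈ Ioc t 1 := by
    rintro b ⟨hb1, hb2⟩
    simp only [q]
    constructor <;> nlinarith [ht.2]
  have hqm : StrictMono q := by
    intro a b hab
    simp only [q]
    nlinarith [ht.2]
  have hτ0 : ∀ a, τ (a, 0) = γ (p a) := fun a => if_pos rfl
  have hτ1 : ∀ b, b ≠ 0 → τ (0, b) = δ (q b) := fun b hb => if_neg hb
  have hτs : τ (0, 0) = γ s := by rw [hτ0, hp0]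
  have hcp : Continuous p := by fun_prop
  have hcq : Continuous q := by fun_prop
  rw [← hτs]
  refine ⟨_, isSimpleTriodWithTop_of_injective ?_ ?_⟩
  · refine ContinuousOn.union_of_isClosed ?_ ?_ (isClosed_Icc.prod isClosed_singleton)
      (isClosed_singleton.prod isClosed_Icc)
    · refine (hγ.cont.comp (hcp.comp continuous_fst)).continuousOn.congr ?_
      rintro ⟨a, b⟩ ⟨-, hb⟩
      obtain rfl : b = 0 := hb
      exact hτ0 a
    · refine (hδ.cont.comp (hcq.comp continuous_snd)).continuousOn.congr ?_
      rintro ⟨a, b⟩ ⟨ha, -⟩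
      obtain rfl : a = 0 := ha
      rcases eq_or_ne b 0 with rfl | hb
      · rw [hτs, hst]
        simp [q]
      · exact hτ1 b hb
  · have hcases : ∀ z ∈ triodModel, (∃ a ∈ Icc (-1 : ℝ) 1, z = (a, 0)) ∨
        ∃ b ∈ Ioc (0 : ℝ) 1, z = (0, b) := by
      rintro ⟨a, b⟩ (⟨ha, hb⟩ | ⟨ha, hb⟩)
      · obtain rfl : b = 0 := hb
        exact Or.inl ⟨a, ha, rfl⟩
      · obtain rfl : a = 0 := ha
        rcases hb.1.eq_or_lt with h0 | h0
        · exact Or.inl ⟨0, by norm_num, by rw [← show (0 : ℝ) = b from h0]⟩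
        · exact Or.inr ⟨b, ⟨h0, hb.2⟩, rfl⟩
    have hmix : ∀ a ∈ Icc (-1 : ℝ) 1, ∀ b ∈ Ioc (0 : ℝ) 1, τ (a, 0) ≠ τ (0, b) := by
      intro a ha b hb
      rw [hτ0, hτ1 b hb.1.ne']
      exact hdisj _ (hpI a ha) _ (hqI b hb)
    intro z hz z' hz' heq
    rcases hcases z hz with ⟨a, ha, rfl⟩ | ⟨b, hb, rfl⟩ <;>
      rcases hcases z' hz' with ⟨a', ha', rfl⟩ | ⟨b', hb', rfl⟩
    · rw [hτ0, hτ0] at heq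
      rw [hpm.injective (hγ.injOn (hpI a ha) (hpI a' ha') heq)]
    · exact absurd heq (hmix a ha b' hb')
    · exact absurd heq.symm (hmix a' ha' b hb)
    · rw [hτ1 b hb.1.ne', hτ1 b' hb'.1.ne'] at heq
      have hsub : Ioc t 1 ⊆ Icc (0 : ℝ) 1 := fun r hr => ⟨ht.1.trans hr.1.le, hr.2⟩
      rw [hqm.injective (hδ.injOn (hsub (hqI b hb)) (hsub (hqI b' hb')) heq)]

end

/-- The relation saying that `x` lies in every subcontinuum containing `v` and `y`. -/
def fanRel {X : Type*} [TopologicalSpace X] (v x y : X) : Prop :=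
  ∀ Q, IsSubcontinuum Q → v ∈ Q → y ∈ Q → x ∈ Q

section
variable {X : Type*} [TopologicalSpace X]

lemma fanRel_self_right {v x : X} : fanRel v x v ↔ x = v :=
  ⟨fun h => h {v} ⟨isCompact_singleton, isConnected_singleton⟩ rfl rfl, fun h _ _ hv _ => h ▸ hv⟩

lemma IsArcParam.fanRel_iff [T2Space X] (hX : IsDendroid (univ : Set X)) {γ : ℝ → X} {A : Set X}
    {v y : X} (hγ : IsArcParam γ A v y) {t : ℝ} (ht : t ∈ Icc (0 : ℝ) 1) {x : X} :
    fanRel v x (γ t) ↔ ∃ s ∈ Icc 0 t, γ s = x := by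
  constructor
  · intro h
    exact h _ (hγ.isSubcontinuum_image ht.1) ⟨0, ⟨le_rfl, ht.1⟩, hγ.zero⟩ ⟨t, ⟨ht.1, le_rfl⟩, rfl⟩
  · rintro ⟨s, hs, rfl⟩ Q hQ hv hy
    have hmem := (hγ.ordConnected_preimage (fun A => hX.2.2 A (subset_univ A)) hQ).out
      ⟨⟨le_rfl, zero_le_one⟩, show γ 0 ∈ Q from hγ.zero ▸ hv⟩ ⟨ht, hy⟩ hs
    exact hmem.2

lemma IsArcParam.setOf_fanRel_eq [T2Space X] (hX : IsDendroid (univ : Set X)) {γ : ℝ → X}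
    {A : Set X} {v y : X} (hγ : IsArcParam γ A v y) : {x | fanRel v x y} = A := by
  rw [← hγ.image]
  ext x
  have := hγ.fanRel_iff hX (right_mem_Icc.mpr zero_le_one) (x := x)
  rw [hγ.one] at this
  exact this

lemma IsDendroid.exists_isArcParam (hX : IsDendroid (univ : Set X)) {x y : X} (hxy : x ≠ y) :
    ∃ γ A, IsArcParam γ A x y := by
  obtain ⟨A, -, -, hAx, hAy⟩ := hX.2.1 x trivial y trivial hxy
  obtain ⟨γ, hγ⟩ := _root_.exists_isArcParam hAx hAy hxy
  exact ⟨γ, A, hγ⟩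

lemma IsDendroid.isArcFromTo [T2Space X] (hX : IsDendroid (univ : Set X)) (v y : X) :
    IsArcFromTo {x | fanRel v x y} v y := by
  rcases eq_or_ne v y with rfl | hvy
  · exact Or.inl ⟨rfl, Set.ext fun x => fanRel_self_right⟩
  · obtain ⟨A, -, hA, hAv, hAy⟩ := hX.2.1 v trivial y trivial hvy
    obtain ⟨γ, hγ⟩ := _root_.exists_isArcParam hAv hAy hvy
    rw [hγ.setOf_fanRel_eq hX]
    exact Or.inr ⟨hvy, hA, hAv, hAy⟩

lemma IsDendroid.isSubcontinuum_setOf_fanRel [T2Space X] (hX : IsDendroid (univ : Set X))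
    (v y : X) : IsSubcontinuum {x | fanRel v x y} := by
  rcases eq_or_ne v y with rfl | hvy
  · have : {x | fanRel v x v} = {v} := Set.ext fun x => fanRel_self_right
    rw [this]
    exact ⟨isCompact_singleton, isConnected_singleton⟩
  · obtain ⟨γ, A, hγ⟩ := hX.exists_isArcParam hvy
    rw [hγ.setOf_fanRel_eq hX]
    exact hγ.isSubcontinuum

lemma fanRel_refl (v a : X) : fanRel v a a := fun _ _ _ ha => ha

lemma fanRel_bot (v a : X) : fanRel v v a := fun _ _ hv _ => hv

lemma fanRel_trans {v a b c : X} (hab : fanRel v a b) (hbc : fanRel v b c) : fanRel v a c :=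
  fun Q hQ hv hc => hab Q hQ hv (hbc Q hQ hv hc)

lemma IsDendroid.fanRel_antisymm [T2Space X] (hX : IsDendroid (univ : Set X)) {v a b : X}
    (hab : fanRel v a b) (hba : fanRel v b a) : a = b := by
  rcases eq_or_ne v b with rfl | hb
  · exact fanRel_self_right.mp hab
  obtain ⟨γ, A, hγ⟩ := hX.exists_isArcParam hb
  have h1 : (1 : ℝ) ∈ Icc (0 : ℝ) 1 := right_mem_Icc.mpr zero_le_one
  rw [← hγ.one, hγ.fanRel_iff hX h1] at hab
  obtain ⟨s, hs, rfl⟩ := hab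
  rw [← hγ.one, hγ.fanRel_iff hX hs] at hba
  obtain ⟨t, ht, hts⟩ := hba
  obtain rfl := hγ.injOn ⟨ht.1, ht.2.trans hs.2⟩ h1 hts
  rw [← hγ.one, le_antisymm hs.2 ht.2]

lemma IsDendroid.fanRel_chain [T2Space X] (hX : IsDendroid (univ : Set X)) {v a b c : X}
    (hac : fanRel v a c) (hbc : fanRel v b c) : fanRel v a b ∨ fanRel v b a := by
  rcases eq_or_ne v c with rfl | hc
  · exact Or.inl (fanRel_self_right.mp hac ▸ fanRel_bot _ _)
  obtain ⟨γ, A, hγ⟩ := hX.exists_isArcParam hc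
  have h1 : (1 : ℝ) ∈ Icc (0 : ℝ) 1 := right_mem_Icc.mpr zero_le_one
  rw [← hγ.one, hγ.fanRel_iff hX h1] at hac hbc
  obtain ⟨s, hs, rfl⟩ := hac
  obtain ⟨t, ht, rfl⟩ := hbc
  rw [hγ.fanRel_iff hX hs, hγ.fanRel_iff hX ht]
  exact (le_total s t).imp (fun h => ⟨s, ⟨hs.1, h⟩, rfl⟩) fun h => ⟨t, ⟨ht.1, h⟩, rfl⟩

lemma IsDendroid.exists_isSimpleTriodWithTop [T2Space X] (hX : IsDendroid (univ : Set X))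
    {v a b c : X} (hc : c ≠ v) (hca : fanRel v c a) (hcb : fanRel v c b)
    (hab : ¬ fanRel v a b) (hba : ¬ fanRel v b a) :
    ∃ T m, m ≠ v ∧ IsSimpleTriodWithTop T m := by
  have h1 : (1 : ℝ) ∈ Icc (0 : ℝ) 1 := right_mem_Icc.mpr zero_le_one
  have hav : v ≠ a := by
    rintro rfl
    exact hab (fanRel_bot _ _)
  have hbv : v ≠ b := by
    rintro rfl
    exact hba (fanRel_bot _ _)
  obtain ⟨γ, A, hγ⟩ := hX.exists_isArcParam hbv
  obtain ⟨δ, B, hδ⟩ := hX.exists_isArcParam hav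
  have hcl : IsClosed {x | fanRel v x a} := (hX.isSubcontinuum_setOf_fanRel v a).1.isClosed
  obtain ⟨s, ⟨hs, hsa⟩, hmax⟩ := (isCompact_Icc.inter_right (hcl.preimage hγ.cont)).exists_isGreatest
    (s := Icc (0 : ℝ) 1 ∩ γ ⁻¹' {x | fanRel v x a})
    ⟨0, left_mem_Icc.mpr zero_le_one, by
      change fanRel v (γ 0) a
      rw [hγ.zero]
      exact fanRel_bot v a⟩
  change fanRel v (γ s) a at hsa
  have hsb : fanRel v (γ s) b := by
    rw [← hγ.one]
    exact (hγ.fanRel_iff hX h1).mpr ⟨s, hs, rfl⟩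
  obtain ⟨u, hu, rfl⟩ : ∃ u ∈ Icc (0 : ℝ) 1, γ u = c := by
    rw [← hγ.one] at hcb
    exact (hγ.fanRel_iff hX h1).mp hcb
  have hs0 : 0 < s := by
    refine (hu.1.lt_of_ne ?_).trans_le (hmax ⟨hu, hca⟩)
    rintro rfl
    exact hc hγ.zero
  have hs1 : s < 1 := by
    refine hs.2.lt_of_ne ?_
    rintro rfl
    exact hba (hγ.one ▸ hsa)
  obtain ⟨t, ht, hts⟩ : ∃ t ∈ Icc (0 : ℝ) 1, δ t = γ s := by
    rw [← hδ.one] at hsa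
    exact (hδ.fanRel_iff hX h1).mp hsa
  have ht1 : t < 1 := by
    refine ht.2.lt_of_ne ?_
    rintro rfl
    exact hab ((hδ.one.symm.trans hts) ▸ hsb)
  obtain ⟨T, hT⟩ := _root_.exists_isSimpleTriodWithTop hγ hδ ⟨hs0, hs1⟩ ⟨ht.1, ht1⟩ hts.symm (by
    intro w hw r hr hwr
    have hrI : r ∈ Icc (0 : ℝ) 1 := ⟨ht.1.trans hr.1.le, hr.2⟩
    have hra : fanRel v (δ r) a := by
      rw [← hδ.one]
      exact (hδ.fanRel_iff hX h1).mpr ⟨r, hrI, rfl⟩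
    have hws : w ≤ s := hmax ⟨hw, show fanRel v (γ w) a from hwr ▸ hra⟩
    have hrs : fanRel v (δ r) (δ t) := by
      rw [hts, ← hwr]
      exact (hγ.fanRel_iff hX hs).mpr ⟨w, ⟨hw.1, hws⟩, rfl⟩
    obtain ⟨r', hr', hrr⟩ := (hδ.fanRel_iff hX ht).mp hrs
    obtain rfl := hδ.injOn ⟨hr'.1, hr'.2.trans ht.2⟩ hrI hrr
    exact hr.1.not_ge hr'.2)
  refine ⟨T, γ s, fun hsv => hs0.ne' ?_, hT⟩
  exact hγ.injOn hs (left_mem_Icc.mpr zero_le_one) (hsv.trans hγ.zero.symm)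

lemma IsFanWithTop.fanRel_of_isPreconnected [T2Space X] {v : X}
    (hX : IsFanWithTop (univ : Set X) v) {Q : Set X} (hQ : IsSubcontinuum Q) (hvQ : v ∉ Q) {a b : X}
    (ha : a ∈ Q) (hb : b ∈ Q) : fanRel v a b ∨ fanRel v b a := by
  have hD := hX.1.1
  by_contra! hcomp
  have hab : a ≠ b := by
    rintro rfl
    exact hcomp.1 (fanRel_refl v a)
  obtain ⟨δ, B, hδ⟩ := hD.exists_isArcParam hab
  have hsub : ∀ {P : Set X}, IsSubcontinuum P → a ∈ P → b ∈ P → δ '' Icc 0 1 ⊆ P := by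
    rintro P hP haP hbP _ ⟨t, ht, rfl⟩
    exact ((hδ.ordConnected_preimage (fun A => hD.2.2 A (subset_univ A)) hP).out
      ⟨left_mem_Icc.mpr zero_le_one, show δ 0 ∈ P from hδ.zero ▸ haP⟩
      ⟨right_mem_Icc.mpr zero_le_one, show δ 1 ∈ P from hδ.one ▸ hbP⟩ ht).2
  have hIa := hD.isSubcontinuum_setOf_fanRel v a
  have hIb := hD.isSubcontinuum_setOf_fanRel v b
  have hcover := hsub (P := {x | fanRel v x a} ∪ {x | fanRel v x b})
    ⟨hIa.1.union hIb.1, hIa.2.union ⟨v, fanRel_bot v a, fanRel_bot v b⟩ hIb.2⟩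
    (Or.inl (fanRel_refl v a)) (Or.inr (fanRel_refl v b))
  have hB : δ '' Icc 0 1 = B := hδ.image
  obtain ⟨c, hcB, hca, hcb⟩ := isPreconnected_closed_iff.mp hδ.isSubcontinuum.2.isPreconnected _ _
    hIa.1.isClosed hIb.1.isClosed (hB ▸ hcover)
    ⟨a, hB ▸ ⟨0, left_mem_Icc.mpr zero_le_one, hδ.zero⟩, fanRel_refl v a⟩
    ⟨b, hB ▸ ⟨1, right_mem_Icc.mpr zero_le_one, hδ.one⟩, fanRel_refl v b⟩
  have hcv : c ≠ v := by
    rintro rfl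
    exact hvQ (hsub hQ ha hb (hB ▸ hcB))
  obtain ⟨T, m, hm, hT⟩ := hD.exists_isSimpleTriodWithTop hcv hca hcb hcomp.1 hcomp.2
  exact hm (hX.1.2 m v ⟨trivial, T, subset_univ T, hT⟩ hX.2)

end

section
variable {X : Type*} [MetricSpace X] {v : X}

lemma IsSmoothFan.isClosed_fanRel (hX : IsSmoothFan (univ : Set X) v) :
    IsClosed {p : X × X | fanRel v p.1 p.2} := by
  have hD := hX.1.1.1
  refine IsSeqClosed.isClosed ?_
  rintro p ⟨x, y⟩ hp hlim
  have hx : Tendsto (fun n => (p n).1) atTop (𝓝 x) := (continuous_fst.tendsto _).comp hlim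
  have hy : Tendsto (fun n => (p n).2) atTop (𝓝 y) := (continuous_snd.tendsto _).comp hlim
  have hA := hX.2 y trivial (fun n => (p n).2) (fun _ => trivial) hy _ (subset_univ _)
    (hD.isArcFromTo v y) (fun n => {x | fanRel v x (p n).2})
    (fun n => ⟨subset_univ _, hD.isArcFromTo v _⟩)
  have hI := hD.isSubcontinuum_setOf_fanRel v
  have hd : Metric.infDist x {x | fanRel v x y} ≤ 0 := by
    refine le_of_tendsto_of_tendsto' ((Metric.continuous_infDist_pt _).tendsto x |>.comp hx) hA
      fun n => ?_
    exact Metric.infDist_le_hausdorffDist_of_mem (hp n)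
      (Metric.hausdorffEDist_ne_top_of_nonempty_of_bounded (hI _).2.nonempty (hI _).2.nonempty
        (hI _).1.isBounded (hI _).1.isBounded)
  exact ((hI y).1.isClosed.mem_iff_infDist_zero (hI y).2.nonempty).mpr
    (hd.antisymm Metric.infDist_nonneg)

theorem IsSmoothFan.fanOrder (hX : IsSmoothFan (univ : Set X) v) : FanOrder v (fanRel v) where
  refl := fanRel_refl v
  trans := fanRel_trans
  antisymm := hX.1.1.1.fanRel_antisymm
  bot := fanRel_bot v
  closed := hX.isClosed_fanRel
  conn a := (hX.1.1.1.isSubcontinuum_setOf_fanRel v a).2.isPreconnected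
  chain := hX.1.1.1.fanRel_chain
  chain_of_isPreconnected hQc hQ hv _ _ ha hb :=
    have : CompactSpace X := ⟨hX.1.1.1.1.1⟩
    hX.1.fanRel_of_isPreconnected ⟨hQc.isCompact, ⟨_, ha⟩, hQ⟩ hv ha hb

lemma IsDendroid.maximal_of_isEndpoint (hX : IsDendroid (univ : Set X)) {e y : X}
    (he : IsEndpoint (univ : Set X) e) (hev : e ≠ v) (hey : fanRel v e y) : y = e := by
  have hvy : v ≠ y := by
    rintro rfl
    exact hev (fanRel_self_right.mp hey)
  obtain ⟨A, -, hA, hAv, hAy⟩ := hX.2.1 v trivial y trivial hvy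
  obtain ⟨γ, hγ⟩ := _root_.exists_isArcParam hAv hAy hvy
  have heA : e ∈ A := by
    rw [← hγ.setOf_fanRel_eq hX]
    exact hey
  obtain ⟨φ, hφ⟩ := hAv
  have hφ0 : (φ 0 : X) = v := hφ
  have h1 : y = φ 1 := (hAy.eq_or_eq φ).resolve_left fun h => hvy (hφ0.symm.trans h.symm)
  have h2 : e = φ 1 :=
    ((he.2 A (subset_univ A) hA heA).eq_or_eq φ).resolve_left fun h => hev (h.trans hφ0)
  exact h1.trans h2.symm

lemma IsRamificationPoint.nontrivial {K : Set X} {x : X} (hx : IsRamificationPoint K x) :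
    Nontrivial X := by
  obtain ⟨-, T, -, φ, -⟩ := hx
  refine ⟨φ ⟨(0, 0), triod_top_mem⟩, φ ⟨(1, 0), Or.inl ⟨by norm_num, rfl⟩⟩, fun h => ?_⟩
  have := congrArg (fun z : triodModel => z.1.1) (φ.injective (Subtype.val_injective h))
  norm_num at this

theorem IsLelekFan.dense_maximal (hX : IsLelekFan (univ : Set X) v) :
    Dense {e | ∀ y, fanRel v e y → y = e} := by
  have hD := hX.1.1.1.1
  have : Nontrivial X := hX.1.1.2.nontrivial
  have : ConnectedSpace X := connectedSpace_iff_univ.mpr hD.1.2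
  have hdense : Dense {x | IsEndpoint (univ : Set X) x} := fun x => hX.2 trivial
  refine (hdense.sdiff_singleton v).mono ?_
  rintro e ⟨he, hev⟩ y hey
  exact hD.maximal_of_isEndpoint he hev hey

end

namespace HeightFan

variable {Z : Type*} [TopologicalSpace Z] [CompactSpace Z] {v : Z} {R : Z → Z → Prop}
  {ρ : Z → ℝ} (h : HeightFan v R ρ)
include h

lemma ordConvex_of_isPreconnected {F : Set Z} (hFc : IsClosed F) (hF : IsPreconnected F)
    (hv : v ∉ F) {a b c : Z} (ha : a ∈ F) (hb : b ∈ F) (hac : R a c) (hcb : R c b) : c ∈ F := by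
  have hav : a ≠ v := fun hav => hv (hav ▸ ha)
  obtain ⟨x, hx, hxc, hcx⟩ := isPreconnected_closed_iff.mp hF _ _ (h.isClosed_lower c)
    (h.isClosed_upper c)
    (fun x hx => h.comp_trans hav (h.chain_of_isPreconnected hFc hF hv hx ha) (Or.inl hac))
    ⟨a, ha, hac⟩ ⟨b, hb, hcb⟩
  exact h.antisymm hxc hcx ▸ hx

lemma lower_mem_of_isPreconnected [T2Space Z] {F : Set Z} (hFc : IsClosed F)
    (hF : IsPreconnected F) (hv : v ∈ F) {b c : Z} (hb : b ∈ F) (hcb : R c b) : c ∈ F := by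
  by_contra hc
  have hcv : c ≠ v := fun hcv => hc (hcv ▸ hv)
  have hcpos := h.pos hcv
  have hbpos : 0 < ρ b := hcpos.trans_le (h.mono hcb)
  have hbv : b ≠ v := h.ne_of_pos hbpos
  obtain ⟨U, hU, hbU, hUF⟩ := h.exists_isRelClopen_separating (A := {b})
    (B := F ∩ {x | ρ x = ρ c}) isClosed_singleton
    (hFc.inter (isClosed_eq h.cont continuous_const)) (by simpa using hbv.symm)
    (by
      rintro ⟨-, hvc⟩
      exact hcpos.ne (h.zero.symm.trans hvc))
    (by
      rintro _ rfl x ⟨hxF, hxc⟩ hcomp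
      exact hc (h.eq_of_comp (h.comp_trans hbv hcomp.symm (Or.inr hcb)) hxc ▸ hxF))
  obtain ⟨x, hxF, ⟨hxU, hcx⟩, hx⟩ := isPreconnected_closed_iff.mp hF
    (insert v U ∩ {x | ρ c ≤ ρ x}) (Uᶜ ∪ {x | ρ x ≤ ρ c})
    (hU.isClosed.inter (isClosed_le continuous_const h.cont))
    (hU.isOpen.isClosed_compl.union (isClosed_le h.cont continuous_const))
    (fun x _ => by
      by_cases hx : x ∈ U ∧ ρ c ≤ ρ x
      · exact Or.inl ⟨Or.inr hx.1, hx.2⟩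
      · rcases not_and_or.mp hx with hx | hx
        · exact Or.inr (Or.inl hx)
        · exact Or.inr (Or.inr (not_le.mp hx).le))
    ⟨b, hb, Or.inr (hbU rfl), h.mono hcb⟩ ⟨v, hv, Or.inl hU.notMem⟩
  have hxU : x ∈ U := hxU.resolve_left (h.ne_of_pos (hcpos.trans_le hcx))
  exact disjoint_left.mp hUF hxU ⟨hxF, le_antisymm (hx.resolve_left (not_not.mpr hxU)) hcx⟩

end HeightFan

/-- The image of a relation under a map. -/
def imageRel {Z Y : Type*} (f : Z → Y) (R : Z → Z → Prop) (y y' : Y) : Prop :=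
  ∃ z z', R z z' ∧ f z = y ∧ f z' = y'

namespace HeightFan

variable {Z Y : Type*} [TopologicalSpace Z] [CompactSpace Z] [T2Space Z] [TopologicalSpace Y]
  [T2Space Y] {v : Z} {R : Z → Z → Prop} {ρ : Z → ℝ} (h : HeightFan v R ρ) {f : Z → Y}
  (hf : Continuous f) (hfib : ∀ y, IsConnected (f ⁻¹' {y}))
include h hf hfib

lemma eq_of_imageRel_bot {y : Y} (hy : imageRel f R y (f v)) : y = f v := by
  obtain ⟨z, z', hz, rfl, hz'⟩ := hy
  exact h.lower_mem_of_isPreconnected (isClosed_singleton.preimage hf) (hfib (f v)).isPreconnected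
    rfl hz' hz

lemma rel_of_imageRel {u u' : Z} (hne : f u ≠ f u') (hv : f u ≠ f v)
    (hu : imageRel f R (f u) (f u')) : R u u' := by
  have hv' : f u' ≠ f v := fun hv' => hv (h.eq_of_imageRel_bot hf hfib (hv' ▸ hu))
  obtain ⟨z, z', hz, hzu, hzu'⟩ := hu
  have hcl : ∀ y, IsClosed (f ⁻¹' {y}) := fun y => isClosed_singleton.preimage hf
  have hcomp : ∀ {y a b}, y ≠ f v → f a = y → f b = y → R a b ∨ R b a :=
    fun {y _ _} hy ha hb => h.chain_of_isPreconnected (hcl y) (hfib y).isPreconnected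
      (fun hvy => hy hvy.symm) ha hb
  have hconv : ∀ {y a b c}, y ≠ f v → f a = y → f b = y → R a c → R c b → f c = y :=
    fun {y _ _ _} hy ha hb hac hcb => h.ordConvex_of_isPreconnected (hcl y)
      (hfib y).isPreconnected (fun hvy => hy hvy.symm) ha hb hac hcb
  have hzv : z ≠ v := by
    rintro rfl
    exact hv hzu.symm
  have hzv' : z' ≠ v := by
    rintro rfl
    exact hv' hzu'.symm
  have huz := hcomp hv rfl hzu
  have huz' : R u z' ∨ R z' u := h.comp_trans hzv huz (Or.inl hz)
  rcases h.comp_trans hzv' huz' (hcomp hv' hzu' rfl) with hR | hR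
  · exact hR
  exfalso
  rcases huz' with hle | hle
  · exact hne (hconv hv' rfl hzu' hR hle)
  · exact hne ((hconv hv hzu rfl hz hle).symm.trans hzu')

theorem fanOrder_imageRel (hsurj : Function.Surjective f) : FanOrder (f v) (imageRel f R) where
  refl y := by
    obtain ⟨z, rfl⟩ := hsurj y
    exact ⟨z, z, h.refl z, rfl, rfl⟩
  bot y := by
    obtain ⟨z, rfl⟩ := hsurj y
    exact ⟨v, z, h.bot z, rfl, rfl⟩
  antisymm {a b} hab hba := by
    obtain ⟨u, rfl⟩ := hsurj a
    obtain ⟨u', rfl⟩ := hsurj b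
    by_contra hne
    by_cases ha : f u = f v
    · exact hne (ha.trans (h.eq_of_imageRel_bot hf hfib (ha ▸ hba)).symm)
    by_cases hb : f u' = f v
    · exact ha (h.eq_of_imageRel_bot hf hfib (hb ▸ hab))
    exact hne (congrArg f (h.antisymm (h.rel_of_imageRel hf hfib hne ha hab)
      (h.rel_of_imageRel hf hfib (Ne.symm hne) hb hba)))
  trans {a b c} hab hbc := by
    obtain ⟨u, rfl⟩ := hsurj a
    obtain ⟨u', rfl⟩ := hsurj b
    obtain ⟨u'', rfl⟩ := hsurj c
    by_cases ha : f u = f v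
    · exact ⟨v, u'', h.bot _, ha.symm, rfl⟩
    by_cases hne : f u = f u'
    · rwa [hne]
    by_cases hne' : f u' = f u''
    · rwa [← hne']
    by_cases hb : f u' = f v
    · exact absurd (h.eq_of_imageRel_bot hf hfib (hb ▸ hab)) ha
    exact ⟨u, u'', h.trans (h.rel_of_imageRel hf hfib hne ha hab)
      (h.rel_of_imageRel hf hfib hne' hb hbc), rfl, rfl⟩
  closed := by
    have himage : {p : Y × Y | imageRel f R p.1 p.2} =
        Prod.map f f '' {p : Z × Z | R p.1 p.2} := by
      ext ⟨y, y'⟩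
      constructor
      · rintro ⟨z, z', hz, rfl, rfl⟩
        exact ⟨(z, z'), hz, rfl⟩
      · rintro ⟨⟨z, z'⟩, hz, heq⟩
        exact ⟨z, z', hz, congrArg Prod.fst heq, congrArg Prod.snd heq⟩
    rw [himage]
    exact (h.closed.isCompact.image (hf.prodMap hf)).isClosed
  conn a := by
    refine isPreconnected_of_forall (f v) ?_
    rintro _ ⟨z, z', hz, rfl, rfl⟩
    refine ⟨f '' {x | R x z'}, ?_, ⟨v, h.bot z', rfl⟩, ⟨z, hz, rfl⟩,
      (h.conn z').image f hf.continuousOn⟩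
    rintro _ ⟨x, hx, rfl⟩
    exact ⟨x, z', hx, rfl, rfl⟩
  chain {a b c} hac hbc := by
    obtain ⟨u, rfl⟩ := hsurj a
    obtain ⟨u', rfl⟩ := hsurj b
    obtain ⟨u'', rfl⟩ := hsurj c
    by_cases ha : f u = f v
    · exact Or.inl ⟨v, u', h.bot _, ha.symm, rfl⟩
    by_cases hb : f u' = f v
    · exact Or.inr ⟨v, u, h.bot _, hb.symm, rfl⟩
    by_cases hne : f u = f u''
    · exact Or.inr (hne ▸ hbc)
    by_cases hne' : f u' = f u''
    · exact Or.inl (hne' ▸ hac)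
    exact (h.chain (h.rel_of_imageRel hf hfib hne ha hac)
      (h.rel_of_imageRel hf hfib hne' hb hbc)).imp
      (fun hR => ⟨u, u', hR, rfl, rfl⟩) fun hR => ⟨u', u, hR, rfl, rfl⟩
  chain_of_isPreconnected {Q} hQc hQ hv a b ha hb := by
    obtain ⟨u, rfl⟩ := hsurj a
    obtain ⟨u', rfl⟩ := hsurj b
    exact (h.chain_of_isPreconnected (hQc.preimage hf)
      (hQ.preimage_of_preconnected_fibers hf hf.isClosedMap hfib hQc) hv
      (a := u) (b := u') ha hb).imp
      (fun hR => ⟨u, u', hR, rfl, rfl⟩) fun hR => ⟨u', u, hR, rfl, rfl⟩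

theorem dense_maximal_imageRel [ConnectedSpace Y] [Nontrivial Y] (hsurj : Function.Surjective f)
    (hmax : Dense {e | ∀ y, R e y → y = e}) :
    Dense {e | ∀ y, imageRel f R e y → y = e} := by
  refine ((hsurj.denseRange.dense_image hf hmax).sdiff_singleton (f v)).mono ?_
  rintro _ ⟨⟨e, he, rfl⟩, hev⟩ y hy
  obtain ⟨u, rfl⟩ := hsurj y
  by_contra hne
  exact hne (congrArg f (he u (h.rel_of_imageRel hf hfib (Ne.symm hne) hev hy)))

end HeightFan

namespace Homeomorph

section
variable {X Y : Type*} [TopologicalSpace X] [TopologicalSpace Y] (g : X ≃ₜ Y)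
include g

lemma isSubcontinuum_image {A : Set X} (hA : IsSubcontinuum A) : IsSubcontinuum (g '' A) :=
  ⟨hA.1.image g.continuous, hA.2.image g g.continuous.continuousOn⟩

lemma isArc_image {A : Set X} : IsArc A → IsArc (g '' A) :=
  fun ⟨φ⟩ => ⟨(g.image A).symm.trans φ⟩

lemma isEndpointOfArc_image {A : Set X} {x : X} :
    IsEndpointOfArc A x → IsEndpointOfArc (g '' A) (g x) := by
  rintro ⟨φ, rfl⟩
  exact ⟨φ.trans (g.image A), rfl⟩

lemma isArcFromTo_image {A : Set X} {x y : X} :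
    IsArcFromTo A x y → IsArcFromTo (g '' A) (g x) (g y) := by
  rintro (⟨rfl, rfl⟩ | ⟨hne, hA, hx, hy⟩)
  · exact Or.inl ⟨rfl, image_singleton⟩
  · exact Or.inr ⟨g.injective.ne hne, g.isArc_image hA, g.isEndpointOfArc_image hx,
      g.isEndpointOfArc_image hy⟩

lemma isSimpleTriodWithTop_image {T : Set X} {x : X} :
    IsSimpleTriodWithTop T x → IsSimpleTriodWithTop (g '' T) (g x) := by
  rintro ⟨φ, rfl⟩
  exact ⟨φ.trans (g.image T), rfl⟩

lemma isRamificationPoint_image {x : X} :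
    IsRamificationPoint (univ : Set X) x → IsRamificationPoint (univ : Set Y) (g x) :=
  fun ⟨_, T, _, hT⟩ => ⟨trivial, g '' T, subset_univ _, g.isSimpleTriodWithTop_image hT⟩

lemma isEndpoint_image {x : X} (hx : IsEndpoint (univ : Set X) x) :
    IsEndpoint (univ : Set Y) (g x) := by
  refine ⟨trivial, fun A _ hA hxA => ?_⟩
  have h := g.isEndpointOfArc_image (hx.2 (g.symm '' A) (subset_univ _) (g.symm.isArc_image hA)
    ⟨g x, hxA, g.symm_apply_apply x⟩)
  rwa [image_symm, image_preimage_eq _ g.surjective] at h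

lemma isUnicoherent_image {A : Set X} (hA : IsUnicoherent A) : IsUnicoherent (g '' A) := by
  intro P Q hP hQ hPQ
  have h := (hA (g.symm '' P) (g.symm '' Q) (g.symm.isSubcontinuum_image hP)
    (g.symm.isSubcontinuum_image hQ) (by
      rw [← image_union, hPQ, image_symm, preimage_image_eq _ g.injective])).image g
      g.continuous.continuousOn
  rwa [← image_inter g.symm.injective, image_symm, image_preimage_eq _ g.surjective] at h

lemma isDendroid_image (hX : IsDendroid (univ : Set X)) : IsDendroid (univ : Set Y) := by
  refine ⟨?_, fun x _ y _ hxy => ?_, fun A _ hA => ?_⟩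
  · simpa only [image_univ_of_surjective g.surjective] using g.isSubcontinuum_image hX.1
  · obtain ⟨A, -, hA, hAx, hAy⟩ := hX.2.1 (g.symm x) trivial (g.symm y) trivial
      (g.symm.injective.ne hxy)
    have hx := g.isEndpointOfArc_image hAx
    have hy := g.isEndpointOfArc_image hAy
    rw [apply_symm_apply] at hx hy
    exact ⟨g '' A, subset_univ _, g.isArc_image hA, hx, hy⟩
  · have h := g.isUnicoherent_image (hX.2.2 (g.symm '' A) (subset_univ _)
      (g.symm.isSubcontinuum_image hA))
    rwa [image_symm, image_preimage_eq _ g.surjective] at h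

lemma isFanWithTop_image {v : X} (hX : IsFanWithTop (univ : Set X) v) :
    IsFanWithTop (univ : Set Y) (g v) :=
  ⟨⟨g.isDendroid_image hX.1.1, fun _ _ hx hy => g.symm.injective
    (hX.1.2 _ _ (g.symm.isRamificationPoint_image hx) (g.symm.isRamificationPoint_image hy))⟩,
    g.isRamificationPoint_image hX.2⟩

end

end Homeomorph

lemma IsArcFromTo.isSubcontinuum {X : Type*} [TopologicalSpace X] {A : Set X} {x y : X}
    (hA : IsArcFromTo A x y) : IsSubcontinuum A := by
  obtain ⟨rfl, rfl⟩ | ⟨hne, -, hx, hy⟩ := hA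
  · exact ⟨isCompact_singleton, isConnected_singleton⟩
  · obtain ⟨γ, hγ⟩ := exists_isArcParam hx hy hne
    exact hγ.isSubcontinuum

section
variable {X Y : Type*} [MetricSpace X] [MetricSpace Y]

lemma UniformContinuous.tendsto_hausdorffDist_image {ι : Type*} {l : Filter ι} {f : X → Y}
    (hf : UniformContinuous f) {As : ι → Set X} {A : Set X} (hAs : ∀ i, IsSubcontinuum (As i))
    (hA : IsSubcontinuum A) (h : Tendsto (fun i => Metric.hausdorffDist (As i) A) l (𝓝 0)) :
    Tendsto (fun i => Metric.hausdorffDist (f '' As i) (f '' A)) l (𝓝 0) := by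
  rw [Metric.tendsto_nhds] at h ⊢
  intro ε hε
  obtain ⟨δ, hδ, hfδ⟩ := Metric.uniformContinuous_iff.mp hf (ε / 2) (half_pos hε)
  filter_upwards [h δ hδ] with i hi
  rw [Real.dist_0_eq_abs, abs_of_nonneg Metric.hausdorffDist_nonneg] at hi ⊢
  have hfin := Metric.hausdorffEDist_ne_top_of_nonempty_of_bounded (hAs i).2.nonempty
    hA.2.nonempty (hAs i).1.isBounded hA.1.isBounded
  refine (Metric.hausdorffDist_le_of_mem_dist (half_pos hε).le ?_ ?_).trans_lt (half_lt_self hε)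
  · rintro _ ⟨x, hx, rfl⟩
    obtain ⟨y, hy, hxy⟩ := Metric.exists_dist_lt_of_hausdorffDist_lt hx hi hfin
    exact ⟨f y, mem_image_of_mem f hy, (hfδ hxy).le⟩
  · rintro _ ⟨y, hy, rfl⟩
    obtain ⟨x, hx, hxy⟩ := Metric.exists_dist_lt_of_hausdorffDist_lt' hy hi hfin
    exact ⟨f x, mem_image_of_mem f hx, by rw [dist_comm]; exact (hfδ hxy).le⟩

lemma Homeomorph.isSmoothFan_image (g : X ≃ₜ Y) {v : X} (hX : IsSmoothFan (univ : Set X) v) :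
    IsSmoothFan (univ : Set Y) (g v) := by
  have : CompactSpace X := ⟨hX.1.1.1.1.1⟩
  refine ⟨g.isFanWithTop_image hX.1, fun y _ ys _ hys A _ hA As hAs => ?_⟩
  have hpull : ∀ {B : Set Y} {z : Y}, IsArcFromTo B (g v) z →
      IsArcFromTo (g.symm '' B) v (g.symm z) := fun hB => by
    simpa only [g.symm_apply_apply] using g.symm.isArcFromTo_image hB
  have h := (CompactSpace.uniformContinuous_of_continuous
    g.continuous).tendsto_hausdorffDist_image (fun n => (hpull (hAs n).2).isSubcontinuum)
    (hpull hA).isSubcontinuum (hX.2 (g.symm y) trivial (fun n => g.symm (ys n))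
      (fun _ => trivial) ((g.symm.continuous.tendsto y).comp hys) (g.symm '' A) (subset_univ _)
      (hpull hA) (fun n => g.symm '' As n) fun n => ⟨subset_univ _, hpull (hAs n).2⟩)
  simpa only [g.image_symm, image_preimage_eq _ g.surjective] using h

theorem Homeomorph.isLelekFan_image (g : X ≃ₜ Y) {v : X} (hX : IsLelekFan (univ : Set X) v) :
    IsLelekFan (univ : Set Y) (g v) := by
  have hdense : Dense {x | IsEndpoint (univ : Set X) x} := fun x => hX.2 trivial
  refine ⟨g.isSmoothFan_image hX.1, fun y _ =>
    (g.surjective.denseRange.dense_image g.continuous hdense).mono ?_ y⟩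
  rintro _ ⟨x, hx, rfl⟩
  exact g.isEndpoint_image hx

theorem FanOrder.exists_heightFan {Z : Type*} [MetricSpace Z] [CompactSpace Z] {v : Z}
    {R : Z → Z → Prop} (h : FanOrder v R) : ∃ ρ, HeightFan v R ρ := by
  obtain ⟨ρ, hcont, hzero, hstrict⟩ := h.exists_height
  exact ⟨ρ, { toFanOrder := h, cont := hcont, zero := hzero, strict := hstrict _ _ }⟩

theorem IsLelekFan.nonempty_homeomorph {v : X} {w : Y} (hX : IsLelekFan (univ : Set X) v)
    (hY : IsLelekFan (univ : Set Y) w) : Nonempty (X ≃ₜ Y) := by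
  have : CompactSpace X := ⟨hX.1.1.1.1.1.1⟩
  have : CompactSpace Y := ⟨hY.1.1.1.1.1.1⟩
  have : Nontrivial X := hX.1.1.2.nontrivial
  have : Nontrivial Y := hY.1.1.2.nontrivial
  obtain ⟨ρ, hρ⟩ := hX.1.fanOrder.exists_heightFan
  obtain ⟨ρ', hρ'⟩ := hY.1.fanOrder.exists_heightFan
  exact hρ.nonempty_homeomorph hρ' hX.dense_maximal hY.dense_maximal

theorem IsLelekFan.nonempty_homeomorph_of_monotone [CompactSpace Y] [ConnectedSpace Y]
    [Nontrivial Y] {v : X} (hX : IsLelekFan (univ : Set X) v) {f : X → Y} (hf : Continuous f)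
    (hsurj : Function.Surjective f) (hfib : ∀ y, IsConnected (f ⁻¹' {y})) : Nonempty (X ≃ₜ Y) := by
  have : CompactSpace X := ⟨hX.1.1.1.1.1.1⟩
  have : Nontrivial X := hX.1.1.2.nontrivial
  obtain ⟨ρ, hρ⟩ := hX.1.fanOrder.exists_heightFan
  obtain ⟨ρ', hρ'⟩ := (hρ.fanOrder_imageRel hf hfib hsurj).exists_heightFan
  exact hρ.nonempty_homeomorph hρ' hX.dense_maximal
    (hρ.dense_maximal_imageRel hf hfib hsurj hX.dense_maximal)

end

/-- for a Lelek fan `L` and a non-degenerate continuum `Y`, TFAE: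
(1) some embedding `e : Y → L` admits a monotone retraction of `L` onto `e(Y)`;
(2) there is a monotone surjection `L → Y`; (3) `Y` is a Lelek fan. -/
theorem stmt15 {L Y : Type*} [MetricSpace L] [MetricSpace Y]
    [CompactSpace Y] [ConnectedSpace Y] [Nontrivial Y]
    (v : L) (hL : IsLelekFan (Set.univ : Set L) v) :
    List.TFAE
      [ ∃ e : Y → L, Topology.IsEmbedding e ∧
          ∃ r : L → L, Continuous r ∧ (∀ x, r x ∈ Set.range e) ∧
            (∀ x ∈ Set.range e, r x = x) ∧
            ∀ y ∈ Set.range e, IsConnected (r ⁻¹' {y}),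
        ∃ f : L → Y, Continuous f ∧ Function.Surjective f ∧
          ∀ y : Y, IsConnected (f ⁻¹' {y}),
        ∃ w : Y, IsLelekFan (Set.univ : Set Y) w ] := by
  tfae_have 1 → 2 := by
    rintro ⟨e, he, r, hr, hmem, hid, hfib⟩
    choose f hf using hmem
    refine ⟨f, ?_, fun y => ⟨e y, he.injective ?_⟩, fun y => ?_⟩
    · rw [he.continuous_iff]
      exact hr.congr fun x => (hf x).symm
    · rw [hf, hid _ ⟨y, rfl⟩]
    · convert hfib (e y) ⟨y, rfl⟩ using 1
      ext x
      rw [mem_preimage, mem_singleton_iff, mem_preimage, mem_singleton_iff, ← hf x,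
        he.injective.eq_iff]
  tfae_have 2 → 3 := by
    rintro ⟨f, hf, hsurj, hfib⟩
    obtain ⟨g⟩ := hL.nonempty_homeomorph_of_monotone hf hsurj hfib
    exact ⟨g v, g.isLelekFan_image hL⟩
  tfae_have 3 → 1 := by
    rintro ⟨w, hw⟩
    obtain ⟨g⟩ := hw.nonempty_homeomorph hL
    exact ⟨g, g.isEmbedding, id, continuous_id, g.surjective, fun _ _ => rfl,
      fun _ _ => isConnected_singleton⟩
  tfae_finish
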